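/- arXiv:1809.09226 — 3 statements merged into one kernel-verified Lean document; each statement's English description precedes it below -/
import Mathlib

section
/- Let G be a finite quasi-simple group with nontrivial center whose quotient by its center is isomorphic to one of the simple groups A6, A7, PSL2(F7), PSL2(F11), PSp4(F3). If G is isomorphic to a subgroup of PGL4(ℂ) (i.e. G acts faithfully on ℙ³), then Z(G) is cyclic of order 3 and G/Z(G) ≅ A6 (so G ≅ 3.A6); moreover the projective action is induced by a linear representation of G on ℂ⁴ that decomposes as a direct sum of a one-dimensional representation and a faithful irreducible three-dimensional representation. -/
/-- A finite group is *quasi-simple* if it is perfect (equal to its commutator subgroup)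
and its quotient by the center is a non-abelian simple group. -/
def IsQuasiSimple (G : Type*) [Group G] : Prop :=
  commutator G = ⊤ ∧ IsSimpleGroup (G ⧸ Subgroup.center G) ∧
    ∃ a b : G ⧸ Subgroup.center G, a * b ≠ b * a

/-- The quotient of `G` by its center is isomorphic to one of the simple groups
`A₆`, `A₇`, `PSL₂(F₇)`, `PSL₂(F₁₁)`, `PSp₄(F₃)`. -/
def CentralQuotientInList (G : Type*) [Group G] : Prop :=
  Nonempty (G ⧸ Subgroup.center G ≃* alternatingGroup (Fin 6)) ∨
  Nonempty (G ⧸ Subgroup.center G ≃* alternatingGroup (Fin 7)) ∨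
  Nonempty (G ⧸ Subgroup.center G ≃* Matrix.ProjectiveSpecialLinearGroup (Fin 2) (ZMod 7)) ∨
  Nonempty (G ⧸ Subgroup.center G ≃* Matrix.ProjectiveSpecialLinearGroup (Fin 2) (ZMod 11)) ∨
  Nonempty (G ⧸ Subgroup.center G ≃*
    (Matrix.symplecticGroup (Fin 2) (ZMod 3) ⧸
      Subgroup.center (Matrix.symplecticGroup (Fin 2) (ZMod 3))))

/-- `PGL₄(ℂ) = GL₄(ℂ)` modulo its center (the scalar matrices), i.e. `Aut(ℙ³)`. -/
noncomputable abbrev PGL4 : Type :=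
  GL (Fin 4) ℂ ⧸ Subgroup.center (GL (Fin 4) ℂ)


def FrobRel (S : Type*) [Group S] (p k : ℕ) : Prop :=
  ∃ g h : S, g ≠ 1 ∧ g ^ p = 1 ∧ g * h = h * g ^ k

lemma frob_A7 : FrobRel (alternatingGroup (Fin 7)) 5 2 := by
  refine ⟨⟨c[0, 1, 2, 3, 4], by rw [Equiv.Perm.mem_alternatingGroup]; decide +kernel⟩,
    ⟨c[1, 3, 4, 2] * c[5, 6], by rw [Equiv.Perm.mem_alternatingGroup]; decide +kernel⟩, ?_, ?_, ?_⟩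
  all_goals decide +kernel

lemma three_A6 : ∃ a b : alternatingGroup (Fin 6), a * b = b * a ∧ a ^ 3 = 1 ∧ b ^ 3 = 1 ∧
    a ≠ 1 ∧ b ≠ 1 ∧ a * b ≠ 1 ∧ a ^ 2 * b ≠ 1 := by
  refine ⟨⟨c[0, 1, 2], by rw [Equiv.Perm.mem_alternatingGroup]; decide +kernel⟩, ⟨c[3, 4, 5], by rw [Equiv.Perm.mem_alternatingGroup]; decide +kernel⟩, ?_⟩
  decide +kernel

lemma frob_quot {S : Type*} [Group S] (p k : ℕ) (g h x : S) (hx : g * x ≠ x * g)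
    (hp : g ^ p = 1) (hgh : g * h = h * g ^ k) : FrobRel (S ⧸ Subgroup.center S) p k := by
  refine ⟨(g : S ⧸ Subgroup.center S), (h : S ⧸ Subgroup.center S), ?_, ?_, ?_⟩
  · intro h1
    rw [QuotientGroup.eq_one_iff, Subgroup.mem_center_iff] at h1
    exact hx (h1 x).symm
  · rw [← QuotientGroup.mk_pow, hp]; rfl
  · rw [← QuotientGroup.mk_pow, ← QuotientGroup.mk_mul, ← QuotientGroup.mk_mul, hgh]

lemma frob_L27 : FrobRel (Matrix.ProjectiveSpecialLinearGroup (Fin 2) (ZMod 7)) 7 2 := by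
  refine frob_quot 7 2 (⟨!![1, 1; 0, 1], by decide +kernel⟩ : Matrix.SpecialLinearGroup (Fin 2) (ZMod 7))
   ⟨!![2, 0; 0, 4], by decide +kernel⟩ ⟨!![1, 0; 1, 1], by decide +kernel⟩ ?_ ?_ ?_
  · decide +kernel
  · decide +kernel
  · decide +kernel

lemma frob_L211 : FrobRel (Matrix.ProjectiveSpecialLinearGroup (Fin 2) (ZMod 11)) 11 3 := by
  refine frob_quot 11 3 (⟨!![1, 1; 0, 1], by decide +kernel⟩ : Matrix.SpecialLinearGroup (Fin 2) (ZMod 11))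
   ⟨!![2, 0; 0, 6], by decide +kernel⟩ ⟨!![1, 0; 1, 1], by decide +kernel⟩ ?_ ?_ ?_
  · decide +kernel
  · decide +kernel
  · decide +kernel

lemma frob_Sp : FrobRel (Matrix.symplecticGroup (Fin 2) (ZMod 3) ⧸
      Subgroup.center (Matrix.symplecticGroup (Fin 2) (ZMod 3))) 5 2 := by
  refine frob_quot 5 2
   (⟨Matrix.fromBlocks !![0, 2; 0, 0] !![1, 0; 2, 0] !![0, 0; 1, 0] !![0, 2; 1, 2],
     by rw [SymplecticGroup.mem_iff]; decide +kernel⟩ : Matrix.symplecticGroup (Fin 2) (ZMod 3))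
   ⟨Matrix.fromBlocks !![1, 2; 2, 0] !![0, 1; 2, 2] !![1, 2; 0, 0] !![0, 0; 2, 2],
     by rw [SymplecticGroup.mem_iff]; decide +kernel⟩ (SymplecticGroup.symJ (Fin 2) (ZMod 3)) ?_ ?_ ?_
  · decide +kernel
  · decide +kernel
  · decide +kernel

lemma card_L27 : ¬ 9 ∣ Nat.card (Matrix.ProjectiveSpecialLinearGroup (Fin 2) (ZMod 7)) := by
  have h1 : Nat.card (Matrix.ProjectiveSpecialLinearGroup (Fin 2) (ZMod 7)) ∣
    Nat.card (Matrix.SpecialLinearGroup (Fin 2) (ZMod 7)) := Subgroup.card_quotient_dvd_card _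
  have h2 : Nat.card (Matrix.SpecialLinearGroup (Fin 2) (ZMod 7)) = 336 := by
    rw [Nat.card_eq_fintype_card]
    decide +kernel
  rw [h2] at h1
  intro h
  have := h.trans h1
  omega

/-! group theory -/

open scoped commutatorElement in
lemma perfect_comm {G M : Type*} [Group G] [Monoid M] (hp : commutator G = ⊤) (r : G →* M)
    (hc : ∀ a b, r a * r b = r b * r a) (g : G) : r g = 1 := by
  have h : commutator G ≤ r.toHomUnits.ker := by
    rw [commutator_def, Subgroup.commutator_le]
    intro a _ b _
    rw [MonoidHom.mem_ker, map_commutatorElement, commutatorElement_eq_one_iff_mul_comm]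
    ext
    exact hc a b
  have h2 : g ∈ r.toHomUnits.ker := h (hp ▸ Subgroup.mem_top g)
  rw [MonoidHom.mem_ker] at h2
  have := congrArg Units.val h2
  simpa using this

/-- descend along a surjection -/
lemma descend {Γ G M : Type*} [Group Γ] [Group G] [Monoid M] (π : Γ →* G)
    (hπ : Function.Surjective π) (r : Γ →* M) (hr : ∀ γ, π γ = 1 → r γ = 1) :
    ∃ s : G →* M, ∀ γ, s (π γ) = r γ := by
  have hk : π.ker ≤ r.toHomUnits.ker := by
    intro γ hγ
    rw [MonoidHom.mem_ker] at *
    ext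
    exact hr γ hγ
  refine ⟨(Units.coeHom M).comp (π.liftOfSurjective hπ ⟨r.toHomUnits, hk⟩), fun γ => ?_⟩
  have := MonoidHom.liftOfRightInverse_comp_apply π _ (Function.rightInverse_surjInv hπ) ⟨r.toHomUnits, hk⟩ γ
  change ((π.liftOfSurjective hπ ⟨r.toHomUnits, hk⟩ (π γ) : Mˣ) : M) = r γ
  rw [this]
  rfl

open scoped commutatorElement in
lemma central_lift {Γ G : Type*} [Group Γ] [Group G] (hp : commutator G = ⊤) (π : Γ →* G)
    (hπ : Function.Surjective π) (hk : π.ker ≤ Subgroup.center Γ) (γ : Γ)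
    (hγ : π γ ∈ Subgroup.center G) : γ ∈ Subgroup.center Γ := by
  have hc : ∀ δ, ⁅γ, δ⁆ ∈ Subgroup.center Γ := fun δ => hk <| by
    rw [MonoidHom.mem_ker, map_commutatorElement, commutatorElement_eq_one_iff_mul_comm]
    exact (Subgroup.mem_center_iff.1 hγ _).symm
  let f : Γ →* Subgroup.center Γ :=
    { toFun := fun δ => ⟨⁅γ, δ⁆, hc δ⟩
      map_one' := by ext; simp
      map_mul' := fun a b => by
        ext
        have h := Subgroup.mem_center_iff.1 (hc b) a
        change ⁅γ, a * b⁆ = ⁅γ, a⁆ * ⁅γ, b⁆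
        have : ⁅γ, a * b⁆ = ⁅γ, a⁆ * (a * ⁅γ, b⁆ * a⁻¹) := by
          simp only [commutatorElement_def]; group
        rw [this, h]; group }
  obtain ⟨s, hs⟩ := descend π hπ f (fun δ hδ => by
    have h := Subgroup.mem_center_iff.1 (hk (show δ ∈ π.ker from hδ)) γ
    ext
    change ⁅γ, δ⁆ = 1
    rw [commutatorElement_eq_one_iff_mul_comm, h])
  rw [Subgroup.mem_center_iff]
  intro δ
  have h1 := perfect_comm hp s (fun a b => Subtype.ext (Subgroup.mem_center_iff.1 (s b).2 _)) (π δ)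
  rw [hs] at h1
  have h2 : ⁅γ, δ⁆ = 1 := congrArg Subtype.val h1
  exact (commutatorElement_eq_one_iff_mul_comm.1 h2).symm

lemma normal_dichotomy {G : Type*} [Group G] (hp : commutator G = ⊤)
    (hs : IsSimpleGroup (G ⧸ Subgroup.center G)) (N : Subgroup G) [N.Normal] :
    N = ⊤ ∨ N ≤ Subgroup.center G := by
  have hn : (N.map (QuotientGroup.mk' (Subgroup.center G))).Normal :=
    Subgroup.Normal.map inferInstance _ (QuotientGroup.mk'_surjective _)
  rcases hn.eq_bot_or_eq_top with h | h
  · right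
    rw [Subgroup.map_eq_bot_iff, QuotientGroup.ker_mk'] at h
    exact h
  · left
    rw [eq_top_iff]
    intro g _
    have key : ∀ g : G, ∃ n ∈ N, ∃ z ∈ Subgroup.center G, g = n * z := by
      intro g
      have : (QuotientGroup.mk' (Subgroup.center G) g) ∈
        N.map (QuotientGroup.mk' (Subgroup.center G)) := h ▸ Subgroup.mem_top _
      obtain ⟨n, hn, hng⟩ := this
      refine ⟨n, hn, n⁻¹ * g, ?_, by group⟩
      exact QuotientGroup.eq.1 hng
    have := perfect_comm hp (QuotientGroup.mk' N) (by
      intro a b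
      obtain ⟨n, hn, z, hz, rfl⟩ := key a
      obtain ⟨m, hm, w, hw, rfl⟩ := key b
      have e1 : QuotientGroup.mk' N n = 1 := (QuotientGroup.eq_one_iff _).2 hn
      have e2 : QuotientGroup.mk' N m = 1 := (QuotientGroup.eq_one_iff _).2 hm
      simp only [map_mul, e1, e2, one_mul]
      rw [← map_mul, ← map_mul, Subgroup.mem_center_iff.1 hz]) g
    exact (QuotientGroup.eq_one_iff _).1 this

lemma transfer_three {G : Type*} [Group G] [Finite G] (hp : commutator G = ⊤)
    (hz : Nat.card (Subgroup.center G) = 3) (h9 : ¬ 9 ∣ Nat.card (G ⧸ Subgroup.center G)) :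
    False := by
  have : Fact (Nat.Prime 3) := ⟨Nat.prime_three⟩
  obtain ⟨P⟩ : Nonempty (Sylow 3 G) := inferInstance
  have hcard := Subgroup.card_eq_card_quotient_mul_card_subgroup (Subgroup.center G)
  rw [hz] at hcard
  have hPc := P.card_eq_multiplicity
  have hle : (Nat.card G).factorization 3 ≤ 2 := by
    by_contra hlt
    have h27 : 3 ^ 3 ∣ Nat.card G :=
      (Nat.prime_three.pow_dvd_iff_le_factorization Nat.card_pos.ne').2 (by omega)
    rw [hcard] at h27
    apply h9
    omega
  have hcomm : IsMulCommutative P := by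
    generalize (Nat.card G).factorization 3 = k at hle hPc
    interval_cases k
    · have : Subsingleton P := (Nat.card_eq_one_iff_unique.1 (by simpa using hPc)).1
      exact ⟨⟨fun a b => Subsingleton.elim _ _⟩⟩
    · have : IsCyclic P := isCyclic_of_prime_card (p := 3) (by simpa using hPc)
      infer_instance
    · exact IsPGroup.isMulCommutative_of_card_eq_prime_sq hPc
  have hnt : Nontrivial (Subgroup.center G) :=
    (Finite.one_lt_card_iff_nontrivial).1 (by omega)
  obtain ⟨z, hz1⟩ := exists_ne (1 : Subgroup.center G)
  have hz3 : z ^ 3 = 1 := by rw [← hz]; exact pow_card_eq_one'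
  let cg : CommGroup P := { (inferInstance : Group P) with mul_comm := hcomm.is_comm.comm }
  have key : ∀ (k : ℕ) (g₀ : G), g₀⁻¹ * (z : G) ^ k * g₀ ∈ (P : Subgroup G) →
      g₀⁻¹ * (z : G) ^ k * g₀ = (z : G) ^ k := by
    intro k g₀ _
    have := Subgroup.mem_center_iff.1 (z ^ k).2 g₀
    rw [mul_assoc, ← Subgroup.coe_pow, ← this]; group
  have h1 := MonoidHom.transfer_eq_pow (H := (P : Subgroup G)) (MonoidHom.id P) (z : G) key
  have h2 := perfect_comm hp (MonoidHom.transfer (H := (P : Subgroup G)) (MonoidHom.id P))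
    (fun a b => mul_comm _ _) (z : G)
  rw [h1] at h2
  have h3 : (z : G) ^ (P : Subgroup G).index = 1 := congrArg Subtype.val h2
  have h4 : z ^ (P : Subgroup G).index = 1 := by ext; exact h3
  have h5 : ¬ 3 ∣ (P : Subgroup G).index := P.not_dvd_index
  have hco : Nat.Coprime 3 (P : Subgroup G).index := (Nat.Prime.coprime_iff_not_dvd Nat.prime_three).2 h5
  apply hz1
  have := pow_gcd_eq_one.2 ⟨hz3, h4⟩
  rw [hco] at this
  simpa using this

/-! linear algebra -/

lemma unip {R : Type*} [Ring R] [Algebra ℂ R] (X : R) (h : (X - 1) * (X - 1) = 0) (n : ℕ)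
    (hn : n ≠ 0) (hX : X ^ n = 1) : X = 1 := by
  have key : ∀ m : ℕ, X ^ m = 1 + (m : ℂ) • (X - 1) := by
    intro m
    induction m with
    | zero => simp
    | succ m ih =>
      have e : X = 1 + (X - 1) := by abel
      rw [pow_succ, ih]
      nth_rewrite 2 [e]
      rw [add_mul, mul_add, mul_add, smul_mul_assoc, smul_mul_assoc, h, smul_zero]
      simp only [mul_one, one_mul, add_zero, Nat.cast_add, Nat.cast_one, add_smul, one_smul]
      rw [add_assoc, add_comm (X - 1)]
  rw [key n] at hX
  have h1 : (n : ℂ) • (X - 1) = 0 := by simpa using hX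
  rcases smul_eq_zero.1 h1 with h2 | h2
  · exact absurd (by exact_mod_cast h2) hn
  · exact sub_eq_zero.1 h2

section
variable {W : Type*} [AddCommGroup W] [Module ℂ W] [FiniteDimensional ℂ W]

lemma exists_root (A : Module.End ℂ W) (p : ℕ) (hp : p ≠ 0) (hA : A ^ p = 1) (h1 : A ≠ 1) :
    ∃ ζ : ℂ, ζ ≠ 1 ∧ ∃ v, v ≠ 0 ∧ A v = ζ • v := by
  let N : Module.End ℂ W := ∑ i ∈ Finset.range p, A ^ i
  have hN : N * (A - 1) = 0 := by
    have := geom_sum_mul A p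
    rw [this, hA, sub_self]
  have hcomm : A * N = N * A := by
    simp only [N, Finset.mul_sum, Finset.sum_mul, ← pow_succ, ← pow_succ']
  let K := LinearMap.ker N
  have hK : ∀ v ∈ K, A v ∈ K := by
    intro v hv
    rw [LinearMap.mem_ker] at *
    change (N * A) v = 0
    rw [← hcomm]
    change A (N v) = 0
    rw [hv, map_zero]
  have hnt : Nontrivial K := by
    have : ∃ w, (A - 1) w ≠ 0 := by
      by_contra hcon
      push Not at hcon
      exact h1 (sub_eq_zero.1 (LinearMap.ext hcon))
    obtain ⟨w, hw⟩ := this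
    refine ⟨⟨⟨(A - 1) w, ?_⟩, 0, fun h => hw (congrArg Subtype.val h)⟩⟩
    rw [LinearMap.mem_ker]
    exact LinearMap.congr_fun hN w
  obtain ⟨ζ, hζ⟩ := Module.End.exists_eigenvalue (A.restrict hK)
  obtain ⟨v, hv⟩ := hζ.exists_hasEigenvector
  have hv1 : A v = ζ • (v : W) := congrArg Subtype.val hv.apply_eq_smul
  have hv0 : (v : W) ≠ 0 := fun h => hv.2 (Subtype.ext h)
  refine ⟨ζ, ?_, v, hv0, hv1⟩
  rintro rfl
  have hz : N v = 0 := v.2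
  have hpw : ∀ i : ℕ, (A ^ i) (v : W) = v := by
    intro i
    induction i with
    | zero => simp
    | succ i ih => rw [pow_succ, Module.End.mul_apply, hv1, one_smul, ih]
  have : N v = (p : ℂ) • (v : W) := by
    change (∑ i ∈ Finset.range p, A ^ i) (v : W) = _
    rw [LinearMap.sum_apply, Finset.sum_congr rfl (fun i _ => hpw i), Finset.sum_const,
      Finset.card_range, Nat.cast_smul_eq_nsmul]
  rw [this] at hz
  rcases smul_eq_zero.1 hz with h | h
  · exact hp (by exact_mod_cast h)
  · exact hv0 h

lemma eig_core (A B : Module.End ℂ W) (hB : Function.Injective B) (p k d : ℕ) (hp : p.Prime)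
    (hA : A ^ p = 1) (h1 : A ≠ 1) (hAB : A * B = B * A ^ k)
    (hd : ∀ i < d, ∀ j < d, k ^ i % p = k ^ j % p → i = j) : d ≤ Module.finrank ℂ W := by
  obtain ⟨ζ, hζ, v, hv0, hv⟩ := exists_root A p hp.ne_zero hA h1
  have hpw : ∀ (μ : ℂ) (x : W), A x = μ • x → ∀ i : ℕ, (A ^ i) x = μ ^ i • x := by
    intro μ x hx i
    induction i with
    | zero => simp
    | succ i ih => rw [pow_succ, Module.End.mul_apply, hx, map_smul, ih, smul_smul, pow_succ']
  have hζp : ζ ^ p = 1 := by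
    have := hpw ζ v hv p
    rw [hA, Module.End.one_apply] at this
    have h2 : (ζ ^ p - 1) • v = 0 := by rw [sub_smul, ← this, one_smul, sub_self]
    rcases smul_eq_zero.1 h2 with h | h
    · exact sub_eq_zero.1 h
    · exact absurd h hv0
  have hord : orderOf ζ = p := by
    have : Fact p.Prime := ⟨hp⟩
    exact orderOf_eq_prime hζp hζ
  have hB0 : ∀ i : ℕ, (B ^ i) v ≠ 0 := by
    intro i
    induction i with
    | zero => simpa
    | succ i ih =>
      rw [pow_succ', Module.End.mul_apply]
      intro h
      exact ih (hB (by rw [h, map_zero]))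
  have hE : ∀ i : ℕ, A ((B ^ i) v) = ζ ^ (k ^ i) • (B ^ i) v := by
    intro i
    induction i with
    | zero => simpa
    | succ i ih =>
      rw [pow_succ', Module.End.mul_apply]
      have := LinearMap.congr_fun hAB ((B ^ i) v)
      rw [Module.End.mul_apply, Module.End.mul_apply, hpw _ _ ih, map_smul] at this
      rw [this, ← pow_mul, pow_succ]
  have hli := Module.End.eigenvectors_linearIndependent' A (fun i : Fin d => ζ ^ (k ^ (i : ℕ)))
    (by
      intro i j hij
      have hij' : ζ ^ (k ^ (i : ℕ)) = ζ ^ (k ^ (j : ℕ)) := hij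
      rw [← pow_mod_orderOf ζ (k ^ (i : ℕ)), ← pow_mod_orderOf ζ (k ^ (j : ℕ)), hord] at hij'
      have hpr : IsPrimitiveRoot ζ p := hord ▸ IsPrimitiveRoot.orderOf ζ
      exact Fin.ext (hd i i.2 j j.2
        (hpr.pow_inj (Nat.mod_lt _ hp.pos) (Nat.mod_lt _ hp.pos) hij'))) (fun i => (B ^ (i : ℕ)) v)
    (fun i => ⟨Module.End.mem_eigenspace_iff.2 (hE i), hB0 i⟩)
  simpa using hli.fintype_card_le_finrank

lemma smul_one_ne {c : ℂ} {W : Type*} [AddCommGroup W] [Module ℂ W] [Nontrivial W] (A : (Module.End ℂ W)ˣ)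
    (h : (A : Module.End ℂ W) = c • 1) : c ≠ 0 := by
  rintro rfl
  rw [zero_smul] at h
  exact A.ne_zero h

omit [FiniteDimensional ℂ W] in
lemma smul_one_inj [Nontrivial W] {c d : ℂ} (h : c • (1 : Module.End ℂ W) = d • 1) : c = d := by
  obtain ⟨v, hv⟩ := exists_ne (0 : W)
  have := LinearMap.congr_fun h v
  exact smul_left_injective ℂ hv (by simpa using this)

lemma eig_proj [Nontrivial W] (A B : Module.End ℂ W) (hB : Function.Injective B) (p k d : ℕ) (hp : p.Prime)
    (c s : ℂ) (hc : c ≠ 0) (hs : s ≠ 0)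
    (hA : A ^ p = s • 1) (h1 : ∀ a : ℂ, A ≠ a • 1) (hAB : A * B = c • (B * A ^ (k + 1)))
    (hk : k ≠ 0) (hkp : k ∣ p - 1)
    (hd : ∀ i < d, ∀ j < d, (k + 1) ^ i % p = (k + 1) ^ j % p → i = j) :
    d ≤ Module.finrank ℂ W := by
  obtain ⟨μ, hμ⟩ := IsAlgClosed.exists_pow_nat_eq c (Nat.pos_of_ne_zero hk)
  have hμ0 : μ ≠ 0 := by
    rintro rfl
    rw [zero_pow hk] at hμ
    exact hc hμ.symm
  let A' := μ • A
  have hA'B : A' * B = B * A' ^ (k + 1) := by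
    simp only [A', smul_pow, smul_mul_assoc, mul_smul_comm, hAB, smul_smul, ← hμ]
    rw [← pow_succ' μ k]
  let t := μ ^ p * s
  have ht0 : t ≠ 0 := mul_ne_zero (pow_ne_zero _ hμ0) hs
  have hA'p : A' ^ p = t • 1 := by
    simp only [A', smul_pow, hA, smul_smul, t]
  have hcomm : ∀ i : ℕ, A' ^ i * B = B * (A' ^ (k + 1)) ^ i := by
    intro i
    induction i with
    | zero => simp
    | succ i ih => rw [pow_succ, mul_assoc, hA'B, ← mul_assoc, ih, mul_assoc, ← pow_succ]
  have htk : t = t ^ (k + 1) := by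
    have h := hcomm p
    rw [← pow_mul, mul_comm (k + 1) p, pow_mul, hA'p, smul_pow, one_pow, smul_mul_assoc, one_mul,
      mul_smul_comm, mul_one] at h
    obtain ⟨v, hv⟩ := exists_ne (0 : W)
    have h2 := LinearMap.congr_fun h v
    have hBv : B v ≠ 0 := fun h => hv (hB (by rw [h, map_zero]))
    exact smul_left_injective ℂ hBv h2
  have htk1 : t ^ k = 1 := by
    rw [pow_succ] at htk
    exact (mul_right_cancel₀ ht0 (by rw [one_mul]; exact htk)).symm
  have htp : t ^ (p - 1) = 1 := by
    obtain ⟨m, hm⟩ := hkp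
    rw [hm, pow_mul, htk1, one_pow]
  have htp' : t ^ p = t := by
    obtain ⟨q, rfl⟩ : ∃ q, p = q + 1 := ⟨p - 1, by have := hp.one_lt; omega⟩
    rw [pow_succ, show t ^ q = 1 from htp, one_mul]
  refine eig_core (t⁻¹ • A') B hB p (k + 1) d hp ?_ ?_ ?_ hd
  · rw [smul_pow, hA'p, smul_smul, inv_pow, htp', inv_mul_cancel₀ ht0, one_smul]
  · intro h
    apply h1 (μ⁻¹ * t)
    rw [← h]
    simp only [A', smul_smul]
    rw [mul_assoc, mul_inv_cancel_left₀ ht0, inv_mul_cancel₀ hμ0, one_smul]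
  · rw [smul_pow, smul_mul_assoc, mul_smul_comm, hA'B, inv_pow, ← htk]

lemma fix_det_one (M : Matrix (Fin 2) (Fin 2) ℂ) (v : Fin 2 → ℂ) (hv : v ≠ 0)
    (hM : M.mulVec v = v) (hd : M.det = 1) : (M - 1) * (M - 1) = 0 := by
  have h0 : (M - 1).det = 0 := by
    rw [← Matrix.exists_mulVec_eq_zero_iff]
    exact ⟨v, hv, by rw [Matrix.sub_mulVec, hM, Matrix.one_mulVec, sub_self]⟩
  rw [Matrix.det_fin_two] at h0 hd
  simp at h0
  ext i j
  fin_cases i <;> fin_cases j <;> simp [Matrix.mul_apply, Fin.sum_univ_two]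
  · linear_combination (M 0 0) * (hd - h0) - hd
  · linear_combination (M 0 1) * (hd - h0)
  · linear_combination (M 1 0) * (hd - h0)
  · linear_combination (M 1 1) * (hd - h0) - hd

lemma three_mat (A B : Matrix (Fin 2) (Fin 2) ℂ) (c s t : ℂ) (hs : s ≠ 0) (ht : t ≠ 0)
    (hAB : A * B = c • (B * A)) (hA : A ^ 3 = s • 1) (hB : B ^ 3 = t • 1)
    (hA1 : ∀ a : ℂ, A ≠ a • 1) :
    ∃ b : ℂ, B = b • 1 ∨ A * B = b • 1 ∨ A ^ 2 * B = b • 1 := by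
  have hdA : A.det ≠ 0 := by
    intro h
    have := congrArg Matrix.det hA
    rw [Matrix.det_pow, h, Matrix.det_smul, Matrix.det_one] at this
    simp at this
    exact pow_ne_zero 2 hs this.symm
  have hdB : B.det ≠ 0 := by
    intro h
    have := congrArg Matrix.det hB
    rw [Matrix.det_pow, h, Matrix.det_smul, Matrix.det_one] at this
    simp at this
    exact pow_ne_zero 2 ht this.symm
  have hc2 : c ^ 2 = 1 := by
    have := congrArg Matrix.det hAB
    rw [Matrix.det_smul, Matrix.det_mul, Matrix.det_mul, Fintype.card_fin] at this
    have h2 : A.det * B.det ≠ 0 := mul_ne_zero hdA hdB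
    apply mul_right_cancel₀ h2
    linear_combination -this
  have hB0 : B ≠ 0 := by
    rintro rfl
    simp at hdB
  have hc3 : c ^ 3 = 1 := by
    have h3 : A ^ 3 * B = c ^ 3 • (B * A ^ 3) := by
      have e : A ^ 3 * B = A * (A * (A * B)) := by noncomm_ring
      rw [e, hAB, mul_smul_comm, mul_smul_comm, ← mul_assoc A B, hAB, smul_mul_assoc,
        mul_smul_comm, mul_assoc, ← mul_assoc A B, hAB, smul_mul_assoc, smul_smul, smul_smul]
      congr 1
      · ring
      · noncomm_ring
    rw [hA, smul_mul_assoc, one_mul, mul_smul_comm, mul_one, smul_smul] at h3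
    have := smul_left_injective ℂ hB0 h3
    apply mul_right_cancel₀ hs
    linear_combination -this
  have hc : c = 1 := by
    calc c = c * c ^ 2 := by rw [hc2, mul_one]
      _ = c ^ 3 := by ring
      _ = 1 := hc3
  rw [hc, one_smul] at hAB
  obtain ⟨a, ha⟩ := Module.End.exists_eigenvalue (Matrix.toLin' A)
  let E := Module.End.eigenspace (Matrix.toLin' A) a
  have hE : ∀ v, v ∈ E ↔ A.mulVec v = a • v := fun v => by
    rw [Module.End.mem_eigenspace_iff, Matrix.toLin'_apply]
  have hBE : ∀ v ∈ E, Matrix.toLin' B v ∈ E := by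
    intro v hv
    rw [hE] at *
    rw [Matrix.toLin'_apply, Matrix.mulVec_mulVec, hAB, ← Matrix.mulVec_mulVec, hv,
      Matrix.mulVec_smul]
  have hnt : Nontrivial E := Submodule.nontrivial_iff_ne_bot.2 ha
  obtain ⟨b, hb⟩ := Module.End.exists_eigenvalue ((Matrix.toLin' B).restrict hBE)
  obtain ⟨v, hv⟩ := hb.exists_hasEigenvector
  have hvB : B.mulVec (v : Fin 2 → ℂ) = b • (v : Fin 2 → ℂ) := congrArg Subtype.val hv.apply_eq_smul
  have hvA : A.mulVec (v : Fin 2 → ℂ) = a • (v : Fin 2 → ℂ) := (hE v).1 v.2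
  have hv0 : (v : Fin 2 → ℂ) ≠ 0 := fun h => hv.2 (Subtype.ext h)
  generalize (v : Fin 2 → ℂ) = w at hvB hvA hv0
  have cube : ∀ (X : Matrix (Fin 2) (Fin 2) ℂ) (x r : ℂ), r ≠ 0 → X ^ 3 = r • 1 →
      X.mulVec w = x • w → x ≠ 0 ∧ (x⁻¹ • X) ^ 3 = 1 ∧ (x⁻¹ • X).mulVec w = w := by
    intro X x r hr hX hw
    have h1 : x ^ 3 = r := by
      have e : (X ^ 3).mulVec w = (x ^ 3) • w := by
        rw [pow_succ, pow_succ, pow_one, ← Matrix.mulVec_mulVec, ← Matrix.mulVec_mulVec, hw,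
          Matrix.mulVec_smul, Matrix.mulVec_smul, hw, Matrix.mulVec_smul, hw, smul_smul, smul_smul]
        congr 1
        ring
      rw [hX, Matrix.smul_mulVec, Matrix.one_mulVec] at e
      exact (smul_left_injective ℂ hv0 e).symm
    have hx : x ≠ 0 := by
      rintro rfl
      apply hr
      rw [← h1]
      simp
    refine ⟨hx, ?_, ?_⟩
    · rw [smul_pow, hX, smul_smul, inv_pow, h1, inv_mul_cancel₀ hr, one_smul]
    · rw [Matrix.smul_mulVec, hw, smul_smul, inv_mul_cancel₀ hx, one_smul]
  obtain ⟨ha0, hA3, hAw⟩ := cube A a s hs hA hvA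
  obtain ⟨hb0, hB3, hBw⟩ := cube B b t ht hB hvB
  have eA : A = a • (a⁻¹ • A) := by rw [smul_smul, mul_inv_cancel₀ ha0, one_smul]
  have eB : B = b • (b⁻¹ • B) := by rw [smul_smul, mul_inv_cancel₀ hb0, one_smul]
  have hcm : (a⁻¹ • A) * (b⁻¹ • B) = (b⁻¹ • B) * (a⁻¹ • A) := by
    simp only [smul_mul_assoc, mul_smul_comm, hAB, smul_smul, mul_comm]
  generalize a⁻¹ • A = A' at *
  generalize b⁻¹ • B = B' at *
  have one_of : ∀ X : Matrix (Fin 2) (Fin 2) ℂ, X.mulVec w = w → X.det = 1 → X ^ 3 = 1 → X = 1 :=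
    fun X h1 h2 h3 => unip X (fix_det_one X w hv0 h1 h2) 3 (by norm_num) h3
  have hu : A'.det ^ 3 = 1 := by rw [← Matrix.det_pow, hA3, Matrix.det_one]
  have hv' : B'.det ^ 3 = 1 := by rw [← Matrix.det_pow, hB3, Matrix.det_one]
  have hu1 : A'.det ≠ 1 := fun h => hA1 a (by rw [eA, one_of A' hAw h hA3])
  have hu2 : A'.det ^ 2 + A'.det + 1 = 0 := by
    apply mul_left_cancel₀ (sub_ne_zero.2 hu1)
    linear_combination hu
  have hfac : (B'.det - 1) * ((B'.det - A'.det) * (B'.det - A'.det ^ 2)) = 0 := by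
    linear_combination hv' - hu + (B'.det * A'.det - B'.det ^ 2) * hu2
  rcases mul_eq_zero.1 hfac with h | h
  · refine ⟨b, Or.inl ?_⟩
    rw [eB, one_of B' hBw (sub_eq_zero.1 h) hB3]
  rcases mul_eq_zero.1 h with h | h
  · refine ⟨a ^ 2 * b, Or.inr (Or.inr ?_)⟩
    rw [eA, eB, smul_pow, smul_mul_smul_comm, one_of (A' ^ 2 * B') ?_ ?_ ?_]
    · rw [← Matrix.mulVec_mulVec, hBw, pow_two, ← Matrix.mulVec_mulVec, hAw, hAw]
    · rw [Matrix.det_mul, Matrix.det_pow, sub_eq_zero.1 h, ← pow_succ, hu]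
    · have hcm' : Commute (A' ^ 2) B' := Commute.pow_left hcm 2
      rw [hcm'.mul_pow, hB3, ← pow_mul, mul_comm 2 3, pow_mul, hA3, one_pow, one_mul]
  · refine ⟨a * b, Or.inr (Or.inl ?_)⟩
    rw [eA, eB, smul_mul_smul_comm, one_of (A' * B') ?_ ?_ ?_]
    · rw [← Matrix.mulVec_mulVec, hBw, hAw]
    · rw [Matrix.det_mul, sub_eq_zero.1 h, ← pow_succ', hu]
    · have hcm' : Commute A' B' := hcm
      rw [hcm'.mul_pow, hB3, hA3, one_mul]

end


def IsSc {W : Type*} [AddCommGroup W] [Module ℂ W] (A : Module.End ℂ W) : Prop :=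
  ∃ c : ℂ, A = c • 1

def NoProj (S : Type) [Group S] (n : ℕ) : Prop :=
  ∀ (Γ : Type) [Group Γ] (W : Type) [AddCommGroup W] [Module ℂ W] [FiniteDimensional ℂ W],
    Module.finrank ℂ W = n → ∀ s : Γ →* S, Function.Surjective s →
    ∀ r : Γ →* Module.End ℂ W, (∀ γ, s γ = 1 ↔ IsSc (r γ)) → False

lemma noProj_iso {S T : Type} [Group S] [Group T] (e : S ≃* T) (n : ℕ) (h : NoProj T n) :
    NoProj S n := by
  intro Γ _ W _ _ _ hW s hs r hr
  refine h Γ W hW (e.toMonoidHom.comp s) (e.surjective.comp hs) r (fun γ => ?_)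
  rw [← hr γ]
  simp

lemma r_ne_zero {Γ W : Type} [Group Γ] [AddCommGroup W] [Module ℂ W] [Nontrivial W]
    (r : Γ →* Module.End ℂ W) (γ : Γ) (c : ℂ) (h : r γ = c • 1) : c ≠ 0 :=
  smul_one_ne (r.toHomUnits γ) h

lemma r_inj {Γ W : Type} [Group Γ] [AddCommGroup W] [Module ℂ W]
    (r : Γ →* Module.End ℂ W) (γ : Γ) : Function.Injective (r γ) := by
  intro v w h
  have h2 := congrArg (r γ⁻¹) h
  rw [← Module.End.mul_apply, ← Module.End.mul_apply, ← map_mul, inv_mul_cancel, map_one] at h2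
  exact h2

lemma noProj_frob (S : Type) [Group S] (p k d n : ℕ) (hS : FrobRel S p (k + 1)) (hp : p.Prime)
    (hk : k ≠ 0) (hkp : k ∣ p - 1)
    (hd : ∀ i < d, ∀ j < d, (k + 1) ^ i % p = (k + 1) ^ j % p → i = j) (hn : n ≠ 0) (hnd : n < d) :
    NoProj S n := by
  intro Γ _ W _ _ _ hW s hs r hr
  obtain ⟨g, h, hg1, hgp, hgh⟩ := hS
  obtain ⟨γ, rfl⟩ := hs g
  obtain ⟨δ, rfl⟩ := hs h
  have hnt : Nontrivial W := Module.nontrivial_of_finrank_pos (R := ℂ) (by omega)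
  obtain ⟨c, hc⟩ := (hr (γ * δ * (δ * γ ^ (k + 1))⁻¹)).1 (by simp [hgh])
  obtain ⟨t, ht⟩ := (hr (γ ^ p)).1 (by simp [hgp])
  have := eig_proj (r γ) (r δ) (r_inj r δ) p k d hp c t (r_ne_zero r _ c hc) (r_ne_zero r _ t ht)
    (by rw [← map_pow, ht]) (fun a ha => hg1 ((hr γ).2 ⟨a, ha⟩)) (by
      rw [← map_mul, show γ * δ = γ * δ * (δ * γ ^ (k + 1))⁻¹ * (δ * γ ^ (k + 1)) by group, map_mul,
        hc, smul_mul_assoc, one_mul, map_mul, map_pow]) hk hkp hd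
  omega

lemma noProj_A6 : NoProj (alternatingGroup (Fin 6)) 2 := by
  intro Γ _ W _ _ _ hW s hs r hr
  obtain ⟨g, h, hgh, hg3, hh3, hg1, hh1, hgh1, hgh2⟩ := three_A6
  obtain ⟨γ, rfl⟩ := hs g
  obtain ⟨δ, rfl⟩ := hs h
  have hnt : Nontrivial W := Module.nontrivial_of_finrank_pos (R := ℂ) (by omega)
  obtain ⟨c, hc⟩ := (hr (γ * δ * (δ * γ)⁻¹)).1 (by simp [hgh])
  obtain ⟨t, ht⟩ := (hr (γ ^ 3)).1 (by simp [hg3])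
  obtain ⟨u, hu⟩ := (hr (δ ^ 3)).1 (by simp [hh3])
  let b := Module.finBasisOfFinrankEq ℂ W hW
  let e := LinearMap.toMatrixAlgEquiv b
  have hAB : r γ * r δ = c • (r δ * r γ) := by
      rw [← map_mul, show γ * δ = γ * δ * (δ * γ)⁻¹ * (δ * γ) by group, map_mul,
        hc, smul_mul_assoc, one_mul, map_mul]
  have back : ∀ (X : Module.End ℂ W) (a : ℂ), e X = a • 1 → X = a • 1 := by
    intro X a h
    apply e.injective
    rw [h, map_smul, map_one]
  obtain ⟨a, ha⟩ := three_mat (e (r γ)) (e (r δ)) c t u (r_ne_zero r _ t ht) (r_ne_zero r _ u hu)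
    (by rw [← map_mul, hAB, map_smul, map_mul])
    (by rw [← map_pow, ← map_pow, ht, map_smul, map_one])
    (by rw [← map_pow, ← map_pow, hu, map_smul, map_one])
    (fun a h => hg1 ((hr γ).2 ⟨a, back _ _ h⟩))
  rcases ha with ha | ha | ha
  · exact hh1 ((hr δ).2 ⟨a, back _ _ ha⟩)
  · apply hgh1
    rw [← map_mul]
    refine (hr _).2 ⟨a, back _ _ ?_⟩
    rw [map_mul, map_mul, ha]
  · apply hgh2
    rw [← map_pow, ← map_mul]
    refine (hr _).2 ⟨a, back _ _ ?_⟩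
    rw [map_mul, map_pow, map_mul, map_pow, ha]

lemma noProj_two {G : Type} [Group G] (h : 
  Nonempty (G ≃* alternatingGroup (Fin 6)) ∨
  Nonempty (G ≃* alternatingGroup (Fin 7)) ∨
  Nonempty (G ≃* Matrix.ProjectiveSpecialLinearGroup (Fin 2) (ZMod 7)) ∨
  Nonempty (G ≃* Matrix.ProjectiveSpecialLinearGroup (Fin 2) (ZMod 11)) ∨
  Nonempty (G ≃*
    (Matrix.symplecticGroup (Fin 2) (ZMod 3) ⧸
      Subgroup.center (Matrix.symplecticGroup (Fin 2) (ZMod 3))))) : NoProj G 2 := by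
  rcases h with ⟨⟨e⟩⟩ | ⟨⟨e⟩⟩ | ⟨⟨e⟩⟩ | ⟨⟨e⟩⟩ | ⟨⟨e⟩⟩
  · exact noProj_iso e _ noProj_A6
  · exact noProj_iso e _ (noProj_frob _ 5 1 4 _ frob_A7 (by norm_num) (by norm_num) (by norm_num)
      (by decide) (by norm_num) (by norm_num))
  · exact noProj_iso e _ (noProj_frob _ 7 1 3 _ frob_L27 (by norm_num) (by norm_num) (by norm_num)
      (by decide) (by norm_num) (by norm_num))
  · exact noProj_iso e _ (noProj_frob _ 11 2 5 _ frob_L211 (by norm_num) (by norm_num) (by norm_num)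
      (by decide) (by norm_num) (by norm_num))
  · exact noProj_iso e _ (noProj_frob _ 5 1 4 _ frob_Sp (by norm_num) (by norm_num) (by norm_num)
      (by decide) (by norm_num) (by norm_num))

lemma noProj_three {G : Type} [Group G] (h : 
  Nonempty (G ≃* alternatingGroup (Fin 7)) ∨
  Nonempty (G ≃* Matrix.ProjectiveSpecialLinearGroup (Fin 2) (ZMod 11)) ∨
  Nonempty (G ≃*
    (Matrix.symplecticGroup (Fin 2) (ZMod 3) ⧸
      Subgroup.center (Matrix.symplecticGroup (Fin 2) (ZMod 3))))) : NoProj G 3 := by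
  rcases h with ⟨⟨e⟩⟩ | ⟨⟨e⟩⟩ | ⟨⟨e⟩⟩
  · exact noProj_iso e _ (noProj_frob _ 5 1 4 _ frob_A7 (by norm_num) (by norm_num) (by norm_num)
      (by decide) (by norm_num) (by norm_num))
  · exact noProj_iso e _ (noProj_frob _ 11 2 5 _ frob_L211 (by norm_num) (by norm_num) (by norm_num)
      (by decide) (by norm_num) (by norm_num))
  · exact noProj_iso e _ (noProj_frob _ 5 1 4 _ frob_Sp (by norm_num) (by norm_num) (by norm_num)
      (by decide) (by norm_num) (by norm_num))

/-! representations -/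

def subRep {Γ W : Type} [Group Γ] [AddCommGroup W] [Module ℂ W] (r : Γ →* Module.End ℂ W)
    (E : Submodule ℂ W) (h : ∀ γ, ∀ v ∈ E, r γ v ∈ E) : Γ →* Module.End ℂ E where
  toFun γ := (r γ).restrict (h γ)
  map_one' := by ext v; simp
  map_mul' a b := by ext v; simp

def quotRep {Γ W : Type} [Group Γ] [AddCommGroup W] [Module ℂ W] (r : Γ →* Module.End ℂ W)
    (E : Submodule ℂ W) (h : ∀ γ, ∀ v ∈ E, r γ v ∈ E) : Γ →* Module.End ℂ (W ⧸ E) where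
  toFun γ := E.mapQ E (r γ) (h γ)
  map_one' := by ext v; simp
  map_mul' a b := by ext v; simp

lemma tri {G W : Type} [Group G] [Finite G] [AddCommGroup W] [Module ℂ W] (r : G →* Module.End ℂ W)
    (E : Submodule ℂ W) (h : ∀ γ, ∀ v ∈ E, r γ v ∈ E) (h1 : ∀ g, subRep r E h g = 1)
    (h2 : ∀ g, quotRep r E h g = 1) (g : G) : r g = 1 := by
  have h1' : ∀ v ∈ E, r g v = v := fun v hv =>
    congrArg Subtype.val (LinearMap.congr_fun (h1 g) ⟨v, hv⟩)
  have h2' : ∀ v, r g v - v ∈ E := fun v => by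
    have := LinearMap.congr_fun (h2 g) (Submodule.Quotient.mk v)
    change (Submodule.Quotient.mk (r g v) : W ⧸ E) = Submodule.Quotient.mk v at this
    exact (Submodule.Quotient.eq E).1 this
  refine unip (r g) ?_ (Nat.card G) Nat.card_pos.ne' (by rw [← map_pow, pow_card_eq_one', map_one])
  ext v
  change r g (r g v - v) - (r g v - v) = 0
  rw [h1' _ (h2' v), sub_self]

lemma sc_of_one {W : Type} [AddCommGroup W] [Module ℂ W] (h : Module.finrank ℂ W = 1)
    (A : Module.End ℂ W) : IsSc A := by
  obtain ⟨v, hv, hw⟩ := finrank_eq_one_iff'.1 h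
  obtain ⟨c, hc⟩ := hw (A v)
  refine ⟨c, ?_⟩
  ext w
  obtain ⟨d, rfl⟩ := hw w
  change A (d • v) = c • (d • v)
  rw [map_smul, ← hc, smul_comm]

lemma triv_of_sc {G W : Type} [Group G] [AddCommGroup W] [Module ℂ W]
    (hp : commutator G = ⊤) (r : G →* Module.End ℂ W) (h : ∀ g, IsSc (r g)) (g : G) : r g = 1 := by
  refine perfect_comm hp r (fun a b => ?_) g
  obtain ⟨c, hc⟩ := h a
  rw [hc]
  simp

lemma charOf {Γ W : Type} [Group Γ] [AddCommGroup W] [Module ℂ W] [Nontrivial W]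
    [FiniteDimensional ℂ W] (r : Γ →* Module.End ℂ W) (h : ∀ g, IsSc (r g)) :
    ∃ χ : Γ →* ℂˣ, ∀ g, r g = (χ g : ℂ) • 1 := by
  choose c hc using h
  let f : Γ →* ℂ :=
    { toFun := c
      map_one' := smul_one_inj (W := W) (by rw [← hc, map_one, one_smul])
      map_mul' := fun a b => smul_one_inj (W := W) (by
        rw [← hc, map_mul, hc, hc, smul_mul_smul_comm, one_mul]) }
  exact ⟨f.toHomUnits, hc⟩

lemma triv_two_red {G W : Type} [Group G] [Finite G] [AddCommGroup W] [Module ℂ W]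
    [FiniteDimensional ℂ W]
    (hp : commutator G = ⊤) (hW : Module.finrank ℂ W = 2) (r : G →* Module.End ℂ W)
    (E : Submodule ℂ W) (h : ∀ γ, ∀ v ∈ E, r γ v ∈ E) (hE : Module.finrank ℂ E = 1) (g : G) :
    r g = 1 := by
  have hq := E.finrank_quotient_add_finrank
  refine tri r E h (triv_of_sc hp _ (fun g => sc_of_one hE _))
    (triv_of_sc hp _ (fun g => sc_of_one (by omega) _)) g

lemma eig_inv {Γ W : Type} [Group Γ] [AddCommGroup W] [Module ℂ W] (r : Γ →* Module.End ℂ W)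
    (γ : Γ) (hγ : γ ∈ Subgroup.center Γ) (a : ℂ) :
    ∀ δ, ∀ v ∈ Module.End.eigenspace (r γ) a, r δ v ∈ Module.End.eigenspace (r γ) a := by
  intro δ v hv
  rw [Module.End.mem_eigenspace_iff] at *
  rw [← Module.End.mul_apply, ← map_mul, ← Subgroup.mem_center_iff.1 hγ, map_mul,
    Module.End.mul_apply, hv, map_smul]

lemma proj_two {Γ G W : Type} [Group Γ] [Group G] [Finite G] [AddCommGroup W] [Module ℂ W]
    [FiniteDimensional ℂ W] (hp : commutator G = ⊤)
    (hs : IsSimpleGroup (G ⧸ Subgroup.center G)) (hno : NoProj (G ⧸ Subgroup.center G) 2)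
    (π : Γ →* G) (hπ : Function.Surjective π) (hk : π.ker ≤ Subgroup.center Γ)
    (hW : Module.finrank ℂ W = 2) (r : Γ →* Module.End ℂ W) (hr : ∀ γ, π γ = 1 → IsSc (r γ))
    (γ : Γ) : IsSc (r γ) := by
  have hnt : Nontrivial W := Module.nontrivial_of_finrank_pos (R := ℂ) (by omega)
  by_cases hcen : ∀ γ, π γ ∈ Subgroup.center G → IsSc (r γ)
  · let N : Subgroup Γ :=
      { carrier := {γ | IsSc (r γ)}
        one_mem' := ⟨1, by simp⟩
        mul_mem' := by
          rintro a b ⟨c, hc⟩ ⟨d, hd⟩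
          exact ⟨c * d, by rw [map_mul, hc, hd, smul_mul_smul_comm, one_mul]⟩
        inv_mem' := by
          rintro a ⟨c, hc⟩
          have hc0 := r_ne_zero r a c hc
          refine ⟨c⁻¹, ?_⟩
          have h1 : r a * r a⁻¹ = 1 := by rw [← map_mul, mul_inv_cancel, map_one]
          rw [hc, smul_mul_assoc, one_mul] at h1
          rw [← h1, smul_smul, inv_mul_cancel₀ hc0, one_smul] }
    have hN : N.Normal := ⟨by
      rintro a ⟨c, hc⟩ g
      refine ⟨c, ?_⟩
      rw [map_mul, map_mul, hc, mul_smul_comm, mul_one, smul_mul_assoc, ← map_mul, mul_inv_cancel,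
        map_one]⟩
    have hNn : (N.map π).Normal := hN.map π hπ
    rcases normal_dichotomy hp hs (N.map π) with h | h
    · have : π γ ∈ N.map π := h ▸ Subgroup.mem_top _
      obtain ⟨δ, hδ, hδγ⟩ := this
      have h3 : δ⁻¹ * γ ∈ N := hr _ (by rw [map_mul, map_inv, hδγ, inv_mul_cancel])
      have h4 := N.mul_mem hδ h3
      rw [mul_inv_cancel_left] at h4
      exact h4
    · exfalso
      refine hno Γ W hW ((QuotientGroup.mk' _).comp π)
        ((QuotientGroup.mk'_surjective _).comp hπ) r (fun γ => ?_)
      rw [MonoidHom.comp_apply, QuotientGroup.mk'_apply, QuotientGroup.eq_one_iff]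
      exact ⟨hcen γ, fun hγ => h ⟨γ, hγ, rfl⟩⟩
  · push Not at hcen
    obtain ⟨δ, hδ, hδr⟩ := hcen
    have hδc := central_lift hp π hπ hk δ hδ
    obtain ⟨a, ha⟩ := Module.End.exists_eigenvalue (r δ)
    let E := Module.End.eigenspace (r δ) a
    have hE : ∀ γ, ∀ v ∈ E, r γ v ∈ E := eig_inv r δ hδc a
    have hEt : E ≠ ⊤ := by
      intro h
      apply hδr
      refine ⟨a, LinearMap.ext fun v => ?_⟩
      exact Module.End.mem_eigenspace_iff.1 (h ▸ Submodule.mem_top : v ∈ E)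
    have hEb : E ≠ ⊥ := ha
    have h1 : Module.finrank ℂ E = 1 := by
      have h2 := Submodule.finrank_lt hEt
      have h3 := Submodule.one_le_finrank_iff.2 hEb
      omega
    have hntE : Nontrivial E := Module.nontrivial_of_finrank_pos (R := ℂ) (by omega)
    obtain ⟨χ, hχ⟩ := charOf (subRep r E hE) (fun g => sc_of_one h1 _)
    let σ : Γ →* Module.End ℂ W :=
      { toFun := fun γ => ((χ γ)⁻¹ : ℂˣ).val • r γ
        map_one' := by simp
        map_mul' := fun x y => by
          rw [map_mul, map_mul, mul_inv, Units.val_mul, smul_mul_smul_comm] }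
    have hσ : ∀ γ, σ γ = ((χ γ)⁻¹ : ℂˣ).val • r γ := fun _ => rfl
    obtain ⟨s, hs'⟩ := descend π hπ σ (by
      intro γ hγ
      obtain ⟨c, hc⟩ := hr γ hγ
      have : c = χ γ := by
        apply smul_one_inj (W := E)
        rw [← hχ]
        ext v
        change _ = r γ v
        rw [hc]
        rfl
      rw [hσ, hc, this, smul_smul, ← Units.val_mul, inv_mul_cancel, Units.val_one, one_smul])
    have h5 := triv_two_red hp hW s E (by
      intro g v hv
      obtain ⟨γ, rfl⟩ := hπ g
      rw [hs', hσ]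
      exact E.smul_mem _ (hE γ v hv)) h1 (π γ)
    rw [hs', hσ] at h5
    refine ⟨χ γ, ?_⟩
    rw [← h5, smul_smul, ← Units.val_mul, mul_inv_cancel, Units.val_one, one_smul]

lemma triv_two {G W : Type} [Group G] [Finite G] [AddCommGroup W] [Module ℂ W]
    [FiniteDimensional ℂ W] (hp : commutator G = ⊤)
    (hs : IsSimpleGroup (G ⧸ Subgroup.center G)) (hno : NoProj (G ⧸ Subgroup.center G) 2)
    (hW : Module.finrank ℂ W = 2) (r : G →* Module.End ℂ W) (g : G) : r g = 1 := by
  refine triv_of_sc hp r (proj_two hp hs hno (MonoidHom.id G) Function.surjective_id ?_ hW r ?_) g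
  · rw [MonoidHom.ker_id]; exact bot_le
  · intro γ h
    have h' : γ = 1 := h
    exact ⟨1, by rw [h']; simp⟩

lemma irr_three {G W : Type} [Group G] [Finite G] [Nontrivial G] [AddCommGroup W] [Module ℂ W]
    [FiniteDimensional ℂ W] (hp : commutator G = ⊤)
    (hs : IsSimpleGroup (G ⧸ Subgroup.center G)) (hno : NoProj (G ⧸ Subgroup.center G) 2)
    (hW : Module.finrank ℂ W = 3) (r : G →* Module.End ℂ W) (hr : Function.Injective r)
    (E : Submodule ℂ W) (h : ∀ γ, ∀ v ∈ E, r γ v ∈ E) : E = ⊥ ∨ E = ⊤ := by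
  by_contra hcon
  push Not at hcon
  have h2 := Submodule.finrank_lt hcon.2
  have h3 := Submodule.one_le_finrank_iff.2 hcon.1
  have hq := E.finrank_quotient_add_finrank
  have key : ∀ g, r g = 1 := by
    have h12 : Module.finrank ℂ E = 1 ∨ Module.finrank ℂ E = 2 := by omega
    rcases h12 with h12 | h12
    · exact tri r E h (triv_of_sc hp _ (fun g => sc_of_one h12 _))
        (triv_two hp hs hno (by omega) _)
    · exact tri r E h (triv_two hp hs hno h12 _)
        (triv_of_sc hp _ (fun g => sc_of_one (by omega) _))
  obtain ⟨g, hg⟩ := exists_ne (1 : G)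
  exact hg (hr (by rw [key, map_one]))

lemma three_concl {G W : Type} [Group G] [Finite G] [Nontrivial G] [AddCommGroup W] [Module ℂ W]
    [FiniteDimensional ℂ W] (hp : commutator G = ⊤)
    (hz : Nontrivial (Subgroup.center G))
    (hs : IsSimpleGroup (G ⧸ Subgroup.center G)) (hno : NoProj (G ⧸ Subgroup.center G) 2)
    (hW : Module.finrank ℂ W = 3) (r : G →* Module.End ℂ W) (hr : Function.Injective r) :
    Nat.card (Subgroup.center G) = 3 ∧ ¬ NoProj (G ⧸ Subgroup.center G) 3 := by
  have hnt : Nontrivial W := Module.nontrivial_of_finrank_pos (R := ℂ) (by omega)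
  have hsc : ∀ z ∈ Subgroup.center G, IsSc (r z) := by
    intro z hz
    obtain ⟨a, ha⟩ := Module.End.exists_eigenvalue (r z)
    rcases irr_three hp hs hno hW r hr (Module.End.eigenspace (r z) a) (eig_inv r z hz a) with h | h
    · exact absurd h ha
    · refine ⟨a, LinearMap.ext fun v => ?_⟩
      exact Module.End.mem_eigenspace_iff.1
        (h ▸ Submodule.mem_top : v ∈ Module.End.eigenspace (r z) a)
  constructor
  · obtain ⟨χ, hχ⟩ := charOf (r.comp (Subgroup.center G).subtype) (fun z => hsc z z.2)
    have h3 : ∀ z, χ z ∈ rootsOfUnity 3 ℂ := by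
      intro z
      rw [mem_rootsOfUnity']
      have h1 := perfect_comm hp ((LinearMap.det : Module.End ℂ W →* ℂ).comp r)
        (fun a b => mul_comm _ _) (z : G)
      have h2 : r z = (χ z : ℂ) • 1 := hχ z
      rw [MonoidHom.comp_apply, h2, LinearMap.det_smul, hW, map_one, mul_one] at h1
      exact h1
    let ψ : Subgroup.center G →* rootsOfUnity 3 ℂ := χ.codRestrict _ h3
    have hψ : Function.Injective ψ := by
      intro x y hxy
      have h1 : χ x = χ y := congrArg Subtype.val hxy
      have hx : r x = (χ x : ℂ) • 1 := hχ x
      have hy : r y = (χ y : ℂ) • 1 := hχ y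
      apply Subtype.ext
      apply hr
      rw [hx, hy, h1]
    have hd := Subgroup.card_dvd_of_injective ψ hψ
    rw [Complex.card_rootsOfUnity] at hd
    rcases (Nat.dvd_prime Nat.prime_three).1 hd with h | h
    · have := Finite.one_lt_card_iff_nontrivial.2 hz
      omega
    · exact h
  · intro hno3
    refine hno3 G W hW (QuotientGroup.mk' _) (QuotientGroup.mk'_surjective _) r (fun γ => ?_)
    rw [QuotientGroup.mk'_apply, QuotientGroup.eq_one_iff]
    refine ⟨hsc γ, ?_⟩
    rintro ⟨c, hc⟩
    rw [Subgroup.mem_center_iff]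
    intro g
    apply hr
    rw [map_mul, map_mul, hc]
    simp


lemma fix_compl {W : Type} [AddCommGroup W] [Module ℂ W] [FiniteDimensional ℂ W]
    (Y : Module.End ℂ W) (n : ℕ) (hn : n ≠ 0) (hY : Y ^ n = 1) :
    IsCompl (LinearMap.ker (Y - 1)) (LinearMap.range (Y - 1)) := by
  have hd : Disjoint (LinearMap.ker (Y - 1)) (LinearMap.range (Y - 1)) := by
    rw [Submodule.disjoint_def]
    rintro v hv ⟨w, rfl⟩
    have h1 : (∑ i ∈ Finset.range n, Y ^ i) ((Y - 1) w) = 0 := by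
      rw [← Module.End.mul_apply, geom_sum_mul, hY, sub_self, LinearMap.zero_apply]
    rw [LinearMap.mem_ker] at hv
    generalize (Y - 1) w = v at *
    have hv' : Y v = v := sub_eq_zero.1 hv
    have hpw : ∀ i : ℕ, (Y ^ i) v = v := by
      intro i
      induction i with
      | zero => simp
      | succ i ih => rw [pow_succ, Module.End.mul_apply, hv', ih]
    rw [LinearMap.sum_apply, Finset.sum_congr rfl (fun i _ => hpw i), Finset.sum_const,
      Finset.card_range, ← Nat.cast_smul_eq_nsmul ℂ] at h1
    rcases smul_eq_zero.1 h1 with h | h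
    · exact absurd (by exact_mod_cast h) hn
    · exact h
  refine ⟨hd, codisjoint_iff.2 (Submodule.eq_top_of_disjoint _ _ ?_ hd)⟩
  have := LinearMap.finrank_range_add_finrank_ker (Y - 1)
  omega

/-- linear action of GL4 -/
noncomputable def stdRep : GL (Fin 4) ℂ →* Module.End ℂ (Fin 4 → ℂ) :=
  ((Matrix.toLinAlgEquiv' : Matrix (Fin 4) (Fin 4) ℂ ≃ₐ[ℂ] _) : Matrix (Fin 4) (Fin 4) ℂ →* Module.End ℂ (Fin 4 → ℂ)).comp
    (Units.coeHom _)

lemma stdRep_apply (M : GL (Fin 4) ℂ) (v : Fin 4 → ℂ) :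
    stdRep M v = Matrix.mulVec (M : Matrix (Fin 4) (Fin 4) ℂ) v := by
  simp [stdRep]

lemma stdRep_inj : Function.Injective stdRep := by
  intro M N h
  apply Units.ext
  exact (Matrix.toLinAlgEquiv' : Matrix (Fin 4) (Fin 4) ℂ ≃ₐ[ℂ] _).injective h

lemma stdRep_scalar (c : ℂˣ) : stdRep (Matrix.GeneralLinearGroup.scalar (Fin 4) c) = (c : ℂ) • 1 := by
  ext v i
  simp [stdRep, Pi.single_apply]

lemma center_scalar (M : GL (Fin 4) ℂ) :
    M ∈ Subgroup.center (GL (Fin 4) ℂ) ↔ IsSc (stdRep M) := by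
  rw [Matrix.GeneralLinearGroup.center_eq_range_scalar]
  constructor
  · rintro ⟨c, rfl⟩
    exact ⟨c, stdRep_scalar c⟩
  · rintro ⟨c, hc⟩
    have hc0 : c ≠ 0 := r_ne_zero stdRep M c hc
    refine ⟨Units.mk0 c hc0, stdRep_inj ?_⟩
    rw [hc, stdRep_scalar]
    rfl


lemma sup_ext {W : Type} [AddCommGroup W] [Module ℂ W] {E F : Submodule ℂ W} (h : IsCompl E F)
    {A B : Module.End ℂ W} (hE : ∀ v ∈ E, A v = B v) (hF : ∀ v ∈ F, A v = B v) : A = B := by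
  ext v
  have hv : v ∈ E ⊔ F := by rw [h.sup_eq_top]; trivial
  obtain ⟨e, he, f, hf, rfl⟩ := Submodule.mem_sup.1 hv
  rw [map_add, map_add, hE e he, hF f hf]

lemma subRep_sc {Γ W : Type} [Group Γ] [AddCommGroup W] [Module ℂ W] (r : Γ →* Module.End ℂ W)
    (E : Submodule ℂ W) (h : ∀ γ, ∀ v ∈ E, r γ v ∈ E) (γ : Γ) (hs : IsSc (r γ)) :
    IsSc (subRep r E h γ) := by
  obtain ⟨c, hc⟩ := hs
  refine ⟨c, ?_⟩
  ext v
  change r γ v = c • (v : W)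
  rw [hc]; rfl

lemma sc_on {Γ W : Type} [Group Γ] [AddCommGroup W] [Module ℂ W] (r : Γ →* Module.End ℂ W)
    (E : Submodule ℂ W) (h : ∀ γ, ∀ v ∈ E, r γ v ∈ E) (γ : Γ) (c : ℂ)
    (hs : subRep r E h γ = c • 1) (v : W) (hv : v ∈ E) : r γ v = c • v :=
  congrArg Subtype.val (LinearMap.congr_fun hs ⟨v, hv⟩)

lemma case22 {Γ G : Type} [Group Γ] [Group G] [Finite G] (hp : commutator G = ⊤)
    (hs : IsSimpleGroup (G ⧸ Subgroup.center G)) (hno : NoProj (G ⧸ Subgroup.center G) 2)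
    (π : Γ →* G) (hπ : Function.Surjective π) (hk : π.ker ≤ Subgroup.center Γ)
    (R : Γ →* Module.End ℂ (Fin 4 → ℂ)) (hR : ∀ γ, π γ = 1 → IsSc (R γ))
    (hRi : ∀ γ, IsSc (R γ) → π γ = 1)
    (E F : Submodule ℂ (Fin 4 → ℂ)) (hEF : IsCompl E F)
    (hE : ∀ γ, ∀ v ∈ E, R γ v ∈ E) (hF : ∀ γ, ∀ v ∈ F, R γ v ∈ F)
    (h2 : Module.finrank ℂ E = 2) (h3 : Module.finrank ℂ F = 2) (a b : G) : a * b = b * a := by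
  have kE := proj_two hp hs hno π hπ hk h2 (subRep R E hE) (fun γ h => subRep_sc R E hE γ (hR γ h))
  have kF := proj_two hp hs hno π hπ hk h3 (subRep R F hF) (fun γ h => subRep_sc R F hF γ (hR γ h))
  obtain ⟨α, rfl⟩ := hπ a
  obtain ⟨β, rfl⟩ := hπ b
  have hc : R (α * β) = R (β * α) := by
    rw [map_mul, map_mul]
    refine sup_ext hEF (fun v hv => ?_) (fun v hv => ?_)
    · obtain ⟨c, hc⟩ := kE α
      obtain ⟨d, hd⟩ := kE β
      rw [Module.End.mul_apply, Module.End.mul_apply, sc_on R E hE β d hd v hv,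
        sc_on R E hE α c hc v hv, map_smul, map_smul, sc_on R E hE β d hd v hv,
        sc_on R E hE α c hc v hv, smul_comm]
    · obtain ⟨c, hc⟩ := kF α
      obtain ⟨d, hd⟩ := kF β
      rw [Module.End.mul_apply, Module.End.mul_apply, sc_on R F hF β d hd v hv,
        sc_on R F hF α c hc v hv, map_smul, map_smul, sc_on R F hF β d hd v hv,
        sc_on R F hF α c hc v hv, smul_comm]
  have h1 : R (α * β * (β * α)⁻¹) = 1 := by
    rw [map_mul, hc, ← map_mul, mul_inv_cancel, map_one]
  have h4 := hRi _ ⟨1, by rw [h1, one_smul]⟩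
  rw [map_mul, map_inv, mul_inv_eq_one, map_mul, map_mul] at h4
  exact h4

lemma case13 {Γ G : Type} [Group Γ] [Group G] [Finite G] [Nontrivial G] (hp : commutator G = ⊤)
    (hz : Nontrivial (Subgroup.center G))
    (hs : IsSimpleGroup (G ⧸ Subgroup.center G)) (hno : NoProj (G ⧸ Subgroup.center G) 2)
    (π : Γ →* G) (hπ : Function.Surjective π) (f : Γ →* GL (Fin 4) ℂ)
    (φ : G →* GL (Fin 4) ℂ ⧸ Subgroup.center (GL (Fin 4) ℂ)) (hφ : Function.Injective φ)
    (hf : ∀ γ, QuotientGroup.mk' (Subgroup.center (GL (Fin 4) ℂ)) (f γ) = φ (π γ))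
    (L W : Submodule ℂ (Fin 4 → ℂ)) (hLW : IsCompl L W)
    (hL : ∀ γ, ∀ v ∈ L, stdRep (f γ) v ∈ L) (hW : ∀ γ, ∀ v ∈ W, stdRep (f γ) v ∈ W)
    (h1 : Module.finrank ℂ L = 1) (h3 : Module.finrank ℂ W = 3) :
    (Nat.card (Subgroup.center G) = 3 ∧ ¬ NoProj (G ⧸ Subgroup.center G) 3) ∧
    ∃ ρ : G →* GL (Fin 4) ℂ,
      (QuotientGroup.mk' (Subgroup.center (GL (Fin 4) ℂ))).comp ρ = φ ∧
      ∃ W₁ W₂ : Submodule ℂ (Fin 4 → ℂ),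
        IsCompl W₁ W₂ ∧ Module.finrank ℂ W₁ = 1 ∧ Module.finrank ℂ W₂ = 3 ∧
        (∀ g : G, ∀ v ∈ W₁, Matrix.mulVec (ρ g : Matrix (Fin 4) (Fin 4) ℂ) v ∈ W₁) ∧
        (∀ g : G, ∀ v ∈ W₂, Matrix.mulVec (ρ g : Matrix (Fin 4) (Fin 4) ℂ) v ∈ W₂) ∧
        (∀ g : G, (∀ v ∈ W₂, Matrix.mulVec (ρ g : Matrix (Fin 4) (Fin 4) ℂ) v = v) → g = 1) ∧
        (∀ U : Submodule ℂ (Fin 4 → ℂ), U ≤ W₂ →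
          (∀ g : G, ∀ v ∈ U, Matrix.mulVec (ρ g : Matrix (Fin 4) (Fin 4) ℂ) v ∈ U) →
          U = ⊥ ∨ U = W₂) := by
  have hnt : Nontrivial L := Module.nontrivial_of_finrank_pos (R := ℂ) (by omega)
  obtain ⟨χ, hχ⟩ := charOf (subRep (stdRep.comp f) L hL) (fun g => sc_of_one h1 _)
  have hχ' : ∀ γ, ∀ v ∈ L, stdRep (f γ) v = (χ γ : ℂ) • v := fun γ v hv =>
    sc_on (stdRep.comp f) L hL γ _ (hχ γ) v hv
  have hcen : ∀ c : ℂˣ, Matrix.GeneralLinearGroup.scalar (Fin 4) c ∈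
      Subgroup.center (GL (Fin 4) ℂ) := fun c => (center_scalar _).2 ⟨c, stdRep_scalar c⟩
  let ρ0 : Γ →* GL (Fin 4) ℂ :=
    { toFun := fun γ => Matrix.GeneralLinearGroup.scalar (Fin 4) (χ γ)⁻¹ * f γ
      map_one' := by simp
      map_mul' := fun a b => by
        have hc := Subgroup.mem_center_iff.1 (hcen (χ b)⁻¹) (f a)
        rw [map_mul, map_mul, mul_inv, map_mul]
        simp only [mul_assoc]
        rw [← mul_assoc _ (f a), ← hc, mul_assoc] }
  have hρ0 : ∀ γ v, stdRep (ρ0 γ) v = ((χ γ)⁻¹ : ℂ) • stdRep (f γ) v := by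
    intro γ v
    change stdRep (Matrix.GeneralLinearGroup.scalar (Fin 4) (χ γ)⁻¹ * f γ) v = _
    rw [map_mul, stdRep_scalar]
    simp
  have hρ0L : ∀ γ, ∀ v ∈ L, stdRep (ρ0 γ) v = v := by
    intro γ v hv
    rw [hρ0, hχ' γ v hv, smul_smul, inv_mul_cancel₀ (χ γ).ne_zero, one_smul]
  have hρ0mk : ∀ γ, QuotientGroup.mk' (Subgroup.center (GL (Fin 4) ℂ)) (ρ0 γ) = φ (π γ) := by
    intro γ
    rw [← hf]
    change QuotientGroup.mk' (Subgroup.center (GL (Fin 4) ℂ))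
      (Matrix.GeneralLinearGroup.scalar (Fin 4) (χ γ)⁻¹ * f γ) = _
    rw [map_mul]
    have : QuotientGroup.mk' (Subgroup.center (GL (Fin 4) ℂ))
      (Matrix.GeneralLinearGroup.scalar (Fin 4) (χ γ)⁻¹) = 1 :=
        (QuotientGroup.eq_one_iff _).2 (hcen _)
    rw [this, one_mul]
  have hker : ∀ γ, π γ = 1 → ρ0 γ = 1 := by
    intro γ hγ
    have h := hρ0mk γ
    rw [hγ, map_one] at h
    obtain ⟨c, hc⟩ := (center_scalar _).1 ((QuotientGroup.eq_one_iff _).1 h)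
    obtain ⟨v, hv⟩ := exists_ne (0 : L)
    have h4 := hρ0L γ v v.2
    rw [hc] at h4
    change c • (v : Fin 4 → ℂ) = v at h4
    have hc1 : c = 1 := by
      have h5 : (c - 1) • (v : Fin 4 → ℂ) = 0 := by rw [sub_smul, h4, one_smul, sub_self]
      rcases smul_eq_zero.1 h5 with h | h
      · exact sub_eq_zero.1 h
      · exact absurd (Subtype.ext h) hv
    apply stdRep_inj
    rw [hc, hc1, one_smul, map_one]
  obtain ⟨ρ, hρ⟩ := descend π hπ ρ0 hker
  have hρmk : ∀ g, QuotientGroup.mk' (Subgroup.center (GL (Fin 4) ℂ)) (ρ g) = φ g := by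
    intro g
    obtain ⟨γ, rfl⟩ := hπ g
    rw [hρ, hρ0mk]
  have hρL : ∀ g, ∀ v ∈ L, stdRep (ρ g) v = v := by
    intro g
    obtain ⟨γ, rfl⟩ := hπ g
    rw [hρ]
    exact hρ0L γ
  have hρW : ∀ g, ∀ v ∈ W, stdRep (ρ g) v ∈ W := by
    intro g
    obtain ⟨γ, rfl⟩ := hπ g
    rw [hρ]
    intro v hv
    rw [hρ0]
    exact W.smul_mem _ (hW γ v hv)
  have hfaith : ∀ g, (∀ v ∈ W, stdRep (ρ g) v = v) → g = 1 := by
    intro g hg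
    have h : stdRep (ρ g) = 1 := sup_ext hLW (hρL g) hg
    have h' : ρ g = 1 := stdRep_inj (by rw [h, map_one])
    apply hφ
    rw [← hρmk, h', map_one, map_one]
  have hri : Function.Injective (subRep (stdRep.comp ρ) W hρW) := by
    intro a b hab
    have hab1 : subRep (stdRep.comp ρ) W hρW (a * b⁻¹) = 1 := by
      rw [map_mul, hab, ← map_mul, mul_inv_cancel, map_one]
    refine mul_inv_eq_one.1 (hfaith _ (fun v hv => ?_))
    exact congrArg Subtype.val (LinearMap.congr_fun hab1 ⟨v, hv⟩)
  refine ⟨three_concl hp hz hs hno h3 _ hri, ρ, MonoidHom.ext hρmk, L, W, hLW, h1, h3, ?_, ?_, ?_, ?_⟩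
  · intro g v hv
    rw [← stdRep_apply, hρL g v hv]
    exact hv
  · intro g v hv
    rw [← stdRep_apply]
    exact hρW g v hv
  · intro g hg
    refine hfaith g (fun v hv => ?_)
    rw [stdRep_apply]
    exact hg v hv
  · intro U hU hUi
    have := irr_three hp hs hno h3 _ hri (U.comap W.subtype) (fun g v hv => by
      have h := hUi g v hv
      rw [← stdRep_apply] at h
      exact h)
    rcases this with h | h
    · left
      rw [eq_bot_iff]
      intro v hv
      have h5 : (⟨v, hU hv⟩ : W) ∈ U.comap W.subtype := hv
      rw [h] at h5
      exact congrArg Subtype.val h5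
    · right
      refine le_antisymm hU (fun v hv => ?_)
      have h5 : (⟨v, hv⟩ : W) ∈ (⊤ : Submodule ℂ W) := trivial
      rw [← h] at h5
      exact h5

lemma split_exists {Γ : Type} [Group Γ] (R : Γ →* Module.End ℂ (Fin 4 → ℂ)) (γ : Γ)
    (hγ : γ ∈ Subgroup.center Γ) (n : ℕ) (hn : n ≠ 0) (hsn : IsSc (R (γ ^ n)))
    (hns : ¬ IsSc (R γ)) :
    ∃ E F : Submodule ℂ (Fin 4 → ℂ), IsCompl E F ∧ (∀ γ, ∀ v ∈ E, R γ v ∈ E) ∧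
      (∀ γ, ∀ v ∈ F, R γ v ∈ F) ∧ E ≠ ⊥ ∧ F ≠ ⊥ := by
  obtain ⟨s, hs⟩ := hsn
  obtain ⟨a, ha⟩ := Module.End.exists_eigenvalue (R γ)
  obtain ⟨v, hv⟩ := ha.exists_hasEigenvector
  have hva : R γ v = a • v := hv.apply_eq_smul
  have ha0 : a ≠ 0 := by
    rintro rfl
    rw [zero_smul] at hva
    exact hv.2 (r_inj R γ (by rw [hva, map_zero]))
  have hpow : ∀ i : ℕ, (R γ ^ i) v = a ^ i • v := by
    intro i
    induction i with
    | zero => simp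
    | succ i ih => rw [pow_succ, Module.End.mul_apply, hva, map_smul, ih, smul_smul, pow_succ']
  have has : a ^ n = s := by
    have h1 := hpow n
    rw [← map_pow, hs] at h1
    change s • v = _ at h1
    have h2 : (s - a ^ n) • v = 0 := by rw [sub_smul, h1, sub_self]
    rcases smul_eq_zero.1 h2 with h | h
    · exact (sub_eq_zero.1 h).symm
    · exact absurd h hv.2
  let Y : Module.End ℂ (Fin 4 → ℂ) := a⁻¹ • R γ
  have hYn : Y ^ n = 1 := by
    change (a⁻¹ • R γ) ^ n = 1
    rw [smul_pow, ← map_pow, hs, smul_smul, inv_pow, has, inv_mul_cancel₀, one_smul]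
    rw [← has]
    exact pow_ne_zero _ ha0
  have hcomm : ∀ δ w, R δ ((Y - 1) w) = (Y - 1) (R δ w) := by
    intro δ w
    change R δ (a⁻¹ • R γ w - w) = a⁻¹ • R γ (R δ w) - R δ w
    rw [map_sub, map_smul, ← Module.End.mul_apply, ← map_mul, Subgroup.mem_center_iff.1 hγ,
      map_mul, Module.End.mul_apply]
  refine ⟨LinearMap.ker (Y - 1), LinearMap.range (Y - 1), fix_compl Y n hn hYn, ?_, ?_, ?_, ?_⟩
  · intro δ w hw
    rw [LinearMap.mem_ker] at *
    rw [← hcomm, hw, map_zero]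
  · rintro δ _ ⟨w, rfl⟩
    exact ⟨R δ w, (hcomm δ w).symm⟩
  · intro h
    apply hv.2
    have : v ∈ LinearMap.ker (Y - 1) := by
      rw [LinearMap.mem_ker]
      change a⁻¹ • R γ v - v = 0
      rw [hva, smul_smul, inv_mul_cancel₀ ha0, one_smul, sub_self]
    rw [h] at this
    exact this
  · intro h
    rw [LinearMap.range_eq_bot, sub_eq_zero] at h
    refine hns ⟨a, ?_⟩
    rw [← h, smul_smul, mul_inv_cancel₀ ha0, one_smul]

lemma main_aux (G : Type) [Group G] [Finite G] (hp : commutator G = ⊤)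
    (hs : IsSimpleGroup (G ⧸ Subgroup.center G))
    (hab : ∃ a b : G ⧸ Subgroup.center G, a * b ≠ b * a) (hz : Nontrivial (Subgroup.center G))
    (hno : NoProj (G ⧸ Subgroup.center G) 2)
    (φ : G →* GL (Fin 4) ℂ ⧸ Subgroup.center (GL (Fin 4) ℂ)) (hφ : Function.Injective φ) :
    (Nat.card (Subgroup.center G) = 3 ∧ ¬ NoProj (G ⧸ Subgroup.center G) 3) ∧
    ∃ ρ : G →* GL (Fin 4) ℂ,
      (QuotientGroup.mk' (Subgroup.center (GL (Fin 4) ℂ))).comp ρ = φ ∧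
      ∃ W₁ W₂ : Submodule ℂ (Fin 4 → ℂ),
        IsCompl W₁ W₂ ∧ Module.finrank ℂ W₁ = 1 ∧ Module.finrank ℂ W₂ = 3 ∧
        (∀ g : G, ∀ v ∈ W₁, Matrix.mulVec (ρ g : Matrix (Fin 4) (Fin 4) ℂ) v ∈ W₁) ∧
        (∀ g : G, ∀ v ∈ W₂, Matrix.mulVec (ρ g : Matrix (Fin 4) (Fin 4) ℂ) v ∈ W₂) ∧
        (∀ g : G, (∀ v ∈ W₂, Matrix.mulVec (ρ g : Matrix (Fin 4) (Fin 4) ℂ) v = v) → g = 1) ∧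
        (∀ U : Submodule ℂ (Fin 4 → ℂ), U ≤ W₂ →
          (∀ g : G, ∀ v ∈ U, Matrix.mulVec (ρ g : Matrix (Fin 4) (Fin 4) ℂ) v ∈ U) →
          U = ⊥ ∨ U = W₂) := by
  let q := QuotientGroup.mk' (Subgroup.center (GL (Fin 4) ℂ))
  let Γ : Subgroup (GL (Fin 4) ℂ × G) :=
    MonoidHom.eqLocus (q.comp (MonoidHom.fst _ _)) (φ.comp (MonoidHom.snd _ _))
  let π : Γ →* G := (MonoidHom.snd _ _).comp Γ.subtype
  let f : Γ →* GL (Fin 4) ℂ := (MonoidHom.fst _ _).comp Γ.subtype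
  have hf : ∀ γ, q (f γ) = φ (π γ) := fun γ => γ.2
  have hπ : Function.Surjective π := by
    intro g
    obtain ⟨M, hM⟩ := QuotientGroup.mk'_surjective _ (φ g)
    exact ⟨⟨(M, g), hM⟩, rfl⟩
  have hfc : ∀ γ, π γ = 1 → f γ ∈ Subgroup.center (GL (Fin 4) ℂ) := by
    intro γ h
    have h1 := hf γ
    rw [h, map_one] at h1
    exact (QuotientGroup.eq_one_iff _).1 h1
  have hk : π.ker ≤ Subgroup.center Γ := by
    intro γ h
    have h' : π γ = 1 := h
    rw [Subgroup.mem_center_iff]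
    intro δ
    apply Subtype.ext
    apply Prod.ext
    · exact Subgroup.mem_center_iff.1 (hfc γ h') (f δ)
    · change π δ * π γ = π γ * π δ
      rw [h', mul_one, one_mul]
  have hR : ∀ γ, π γ = 1 → IsSc (stdRep.comp f γ) := fun γ h => (center_scalar _).1 (hfc γ h)
  have hRi : ∀ γ, IsSc (stdRep.comp f γ) → π γ = 1 := by
    intro γ h
    apply hφ
    rw [← hf, map_one]
    exact (QuotientGroup.eq_one_iff _).2 ((center_scalar _).2 h)
  obtain ⟨z, hz1⟩ := exists_ne (1 : Subgroup.center G)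
  have hGn : Nontrivial G := ⟨z, 1, fun h => hz1 (Subtype.ext h)⟩
  obtain ⟨γ, hγ⟩ := hπ z
  have hγc : γ ∈ Subgroup.center Γ := central_lift hp π hπ hk γ (by rw [hγ]; exact z.2)
  obtain ⟨E, F, hEF, hE, hF, hE0, hF0⟩ := split_exists (stdRep.comp f) γ hγc (Nat.card G)
    Nat.card_pos.ne' (hR _ (by rw [map_pow, pow_card_eq_one']))
    (fun h => hz1 (Subtype.ext (by rw [← hγ, hRi γ h]; rfl)))
  have hE1 := Submodule.one_le_finrank_iff.2 hE0
  have hF1 := Submodule.one_le_finrank_iff.2 hF0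
  have hsum := Submodule.finrank_add_eq_of_isCompl hEF
  rw [Module.finrank_fin_fun] at hsum
  have hcases : (Module.finrank ℂ E = 1 ∧ Module.finrank ℂ F = 3) ∨
      (Module.finrank ℂ F = 1 ∧ Module.finrank ℂ E = 3) ∨
      (Module.finrank ℂ E = 2 ∧ Module.finrank ℂ F = 2) := by omega
  rcases hcases with ⟨h1, h3⟩ | ⟨h1, h3⟩ | ⟨h2, h3⟩
  · exact case13 hp hz hs hno π hπ f φ hφ hf E F hEF hE hF h1 h3
  · exact case13 hp hz hs hno π hπ f φ hφ hf F E hEF.symm hF hE h1 h3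
  · exfalso
    obtain ⟨a, b, hab⟩ := hab
    obtain ⟨a, rfl⟩ := QuotientGroup.mk'_surjective _ a
    obtain ⟨b, rfl⟩ := QuotientGroup.mk'_surjective _ b
    apply hab
    rw [← map_mul, ← map_mul, case22 hp hs hno π hπ hk (stdRep.comp f) hR hRi E F hEF hE hF h2 h3 a b]

/-- If a finite quasi-simple group `G` with nontrivial center, whose central quotient is one of
`A₆`, `A₇`, `PSL₂(F₇)`, `PSL₂(F₁₁)`, `PSp₄(F₃)`, embeds into `PGL₄(ℂ) = Aut(ℙ³)`, then its
center is cyclic of order `3`, `G/Z(G) ≅ A₆` (so `G ≅ 3.A₆`), and the projective action is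
induced by a linear representation of `G` on `ℂ⁴` which splits as the direct sum of a
one-dimensional representation and a faithful irreducible three-dimensional representation. -/
theorem quasisimple_in_PGL4 (G : Type) [Group G] [Finite G]
    (hqs : IsQuasiSimple G) (hz : Nontrivial (Subgroup.center G))
    (hlist : CentralQuotientInList G)
    (φ : G →* PGL4) (hφ : Function.Injective φ) :
    Nat.card (Subgroup.center G) = 3 ∧ IsCyclic (Subgroup.center G) ∧
    Nonempty (G ⧸ Subgroup.center G ≃* alternatingGroup (Fin 6)) ∧
    ∃ ρ : G →* GL (Fin 4) ℂ,
      (QuotientGroup.mk' (Subgroup.center (GL (Fin 4) ℂ))).comp ρ = φ ∧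
      ∃ W₁ W₂ : Submodule ℂ (Fin 4 → ℂ),
        IsCompl W₁ W₂ ∧ Module.finrank ℂ W₁ = 1 ∧ Module.finrank ℂ W₂ = 3 ∧
        (∀ g : G, ∀ v ∈ W₁, Matrix.mulVec (ρ g : Matrix (Fin 4) (Fin 4) ℂ) v ∈ W₁) ∧
        (∀ g : G, ∀ v ∈ W₂, Matrix.mulVec (ρ g : Matrix (Fin 4) (Fin 4) ℂ) v ∈ W₂) ∧
        (∀ g : G, (∀ v ∈ W₂, Matrix.mulVec (ρ g : Matrix (Fin 4) (Fin 4) ℂ) v = v) → g = 1) ∧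
        (∀ U : Submodule ℂ (Fin 4 → ℂ), U ≤ W₂ →
          (∀ g : G, ∀ v ∈ U, Matrix.mulVec (ρ g : Matrix (Fin 4) (Fin 4) ℂ) v ∈ U) →
          U = ⊥ ∨ U = W₂) := by
  obtain ⟨hp, hs, hab⟩ := hqs
  obtain ⟨⟨h3, hn3⟩, hρ⟩ := main_aux G hp hs hab hz (noProj_two hlist) φ hφ
  have : Fact (Nat.Prime 3) := ⟨Nat.prime_three⟩
  refine ⟨h3, isCyclic_of_prime_card h3, ?_, hρ⟩
  rcases hlist with h | h | h | h | h
  · exact h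
  · exact absurd (noProj_three (Or.inl h)) hn3
  · obtain ⟨e⟩ := h
    refine (transfer_three hp h3 ?_).elim
    rw [Nat.card_congr e.toEquiv]
    exact card_L27
  · exact absurd (noProj_three (Or.inr (Or.inl h))) hn3
  · exact absurd (noProj_three (Or.inr (Or.inr h))) hn3
end

section
/- Let G be a finite quasi-simple group with nontrivial center whose quotient by its center is isomorphic to one of the simple groups A6, A7, PSL2(F7), PSL2(F11), PSp4(F3) (equivalently, G is one of SL2(F7), SL2(F11), Sp4(F3), n.A6 or n.A7 with n ∈ {2,3,6}). Then every group homomorphism G → GL3(ℚ) is trivial; in particular G has no nontrivial rational representation of dimension at most 3. -/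
open Polynomial in
theorem endo_pow_prime_eq_one {V : Type} [AddCommGroup V] [Module ℚ V] [FiniteDimensional ℚ V]
    (hV : Module.finrank ℚ V ≤ 3) {p : ℕ} (hp : p.Prime) (h5 : 5 ≤ p)
    (A : Module.End ℚ V) (hA : A ^ p = 1) : A = 1 := by
  have hirr : Irreducible (cyclotomic p ℚ) := cyclotomic.irreducible_rat hp.pos
  have hdvd : minpoly ℚ A ∣ cyclotomic p ℚ * (X - 1) := by
    rw [cyclotomic_prime_mul_X_sub_one ℚ p (hn := ⟨hp⟩)]
    apply minpoly.dvd
    simp [hA]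
  have hint : IsIntegral ℚ A := Algebra.IsIntegral.isIntegral A
  have hdeg : (minpoly ℚ A).natDegree ≤ 3 := by
    refine le_trans ?_ hV
    rw [← LinearMap.charpoly_natDegree A]
    exact natDegree_le_of_dvd (LinearMap.minpoly_dvd_charpoly A) (LinearMap.charpoly_monic A).ne_zero
  have hnd : ¬ cyclotomic p ℚ ∣ minpoly ℚ A := by
    intro h
    have := natDegree_le_of_dvd h (minpoly.ne_zero hint)
    rw [natDegree_cyclotomic, Nat.totient_prime hp] at this
    omega
  have hcop : IsCoprime (minpoly ℚ A) (cyclotomic p ℚ) :=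
    (hirr.coprime_iff_not_dvd.2 hnd).symm
  have h1 : minpoly ℚ A ∣ X - 1 := hcop.dvd_of_dvd_mul_left hdvd
  obtain ⟨r, hr⟩ := h1
  have := congrArg (aeval A) hr
  simp only [map_sub, aeval_X, map_one, map_mul, minpoly.aeval, zero_mul] at this
  exact sub_eq_zero.1 this

theorem endo_pow_prime_pow_eq_one {V : Type} [AddCommGroup V] [Module ℚ V] [FiniteDimensional ℚ V]
    (hV : Module.finrank ℚ V ≤ 3) {p : ℕ} (hp : p.Prime) (h5 : 5 ≤ p)
    (A : Module.End ℚ V) (k : ℕ) (hA : A ^ (p ^ k) = 1) : A = 1 := by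
  induction k with
  | zero => simpa using hA
  | succ k ih =>
    apply ih
    apply endo_pow_prime_eq_one hV hp h5
    rw [← pow_mul, ← pow_succ, hA]

theorem rep_trivial_aux (G : Type) [Group G] [Finite G]
    (hqs : IsQuasiSimple G) {p : ℕ} (hp : p.Prime) (h5 : 5 ≤ p)
    (q : G ⧸ Subgroup.center G) (hq : q ≠ 1) (hqp : q ^ p = 1)
    {V : Type} [AddCommGroup V] [Module ℚ V] [FiniteDimensional ℚ V]
    (hV : Module.finrank ℚ V ≤ 3) (ρ : G →* Module.End ℚ V) (g : G) : ρ g = 1 := by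
  obtain ⟨hperf, hsimp, -⟩ := hqs
  obtain ⟨x, rfl⟩ := QuotientGroup.mk_surjective q
  obtain ⟨k, m, hm, hxm⟩ := Nat.exists_eq_pow_mul_and_not_dvd (orderOf_pos x).ne' p hp.ne_one
  have hy : ρ (x ^ m) = 1 := by
    apply endo_pow_prime_pow_eq_one hV hp h5 _ k
    rw [← map_pow, ← pow_mul, mul_comm, ← hxm, pow_orderOf_eq_one, map_one]
  have hyq : ((x ^ m : G) : G ⧸ Subgroup.center G) ≠ 1 := by
    intro h
    rw [QuotientGroup.mk_pow] at h
    have ho := orderOf_eq_prime_iff (hp := ⟨hp⟩) |>.2 ⟨hqp, hq⟩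
    exact hm (ho ▸ orderOf_dvd_of_pow_eq_one h)
  set N := ρ.ker with hN
  have hnorm : (N.map (QuotientGroup.mk' (Subgroup.center G))).Normal :=
    Subgroup.Normal.map inferInstance _ (QuotientGroup.mk'_surjective _)
  have htop : N.map (QuotientGroup.mk' (Subgroup.center G)) = ⊤ := by
    rcases hnorm.eq_bot_or_eq_top with h | h
    · exfalso
      apply hyq
      have : ((x ^ m : G) : G ⧸ Subgroup.center G) ∈
        N.map (QuotientGroup.mk' (Subgroup.center G)) := ⟨x ^ m, hy, rfl⟩
      rw [h] at this
      exact this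
    · exact h
  have hcomm : ∀ a b : G, ρ (a * b) = ρ (b * a) := by
    intro a b
    have : (a : G ⧸ Subgroup.center G) ∈ N.map (QuotientGroup.mk' (Subgroup.center G)) := by
      rw [htop]; trivial
    obtain ⟨n, hn, hna⟩ := this
    have hz : n⁻¹ * a ∈ Subgroup.center G := QuotientGroup.eq.1 hna
    have hn1 : ρ n = 1 := hn
    have ha : ρ a = ρ (n⁻¹ * a) := by
      conv_lhs => rw [← mul_inv_cancel_left n a, map_mul, hn1, one_mul]
    rw [map_mul, map_mul, ha, ← map_mul, ← map_mul, Subgroup.mem_center_iff.1 hz b]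
  have hle : commutator G ≤ N := by
    rw [commutator_def, Subgroup.commutator_le]
    intro a _ b _
    change ρ (a * b * a⁻¹ * b⁻¹) = 1
    have : a * b * a⁻¹ * b⁻¹ = (a * b) * (b * a)⁻¹ := by group
    rw [this, map_mul, hcomm a b, ← map_mul, mul_inv_cancel, map_one]
  have : g ∈ N := hle (hperf ▸ Subgroup.mem_top g)
  exact this

theorem exists_q_alt (n : ℕ) (hn : n = 6 ∨ n = 7) :
    ∃ q : alternatingGroup (Fin n), q ≠ 1 ∧ q ^ 5 = 1 := by
  have h : 5 ∣ Nat.card (alternatingGroup (Fin n)) := by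
    rcases hn with rfl | rfl <;> rw [nat_card_alternatingGroup] <;> simp <;> decide
  haveI : Fact (Nat.Prime 5) := ⟨by norm_num⟩
  obtain ⟨q, hq⟩ := exists_prime_orderOf_dvd_card' 5 h
  have := orderOf_eq_prime_iff.1 hq
  exact ⟨q, this.2, this.1⟩

theorem exists_q_quot {H : Type} [Group H] (p : ℕ) (x y : H) (hx : x ^ p = 1)
    (hxy : y * x ≠ x * y) : ∃ q : H ⧸ Subgroup.center H, q ≠ 1 ∧ q ^ p = 1 := by
  refine ⟨x, ?_, ?_⟩
  · intro h
    exact hxy (Subgroup.mem_center_iff.1 ((QuotientGroup.eq_one_iff x).1 h) y)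
  · rw [← QuotientGroup.mk_pow, hx, QuotientGroup.mk_one]

theorem exists_q_seven : ∃ q : Matrix.ProjectiveSpecialLinearGroup (Fin 2) (ZMod 7),
    q ≠ 1 ∧ q ^ 7 = 1 := by
  refine exists_q_quot 7 ⟨!![1, 1; 0, 1], by decide⟩ ⟨!![1, 0; 1, 1], by decide⟩ ?_ ?_
  · apply Subtype.ext; decide
  · intro h; exact absurd (congrArg Subtype.val h) (by decide)

theorem exists_q_eleven : ∃ q : Matrix.ProjectiveSpecialLinearGroup (Fin 2) (ZMod 11),
    q ≠ 1 ∧ q ^ 11 = 1 := by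
  refine exists_q_quot 11 ⟨!![1, 1; 0, 1], by decide⟩ ⟨!![1, 0; 1, 1], by decide⟩ ?_ ?_
  · apply Subtype.ext; decide
  · intro h; exact absurd (congrArg Subtype.val h) (by decide)

def spA : Matrix (Fin 2 ⊕ Fin 2) (Fin 2 ⊕ Fin 2) (ZMod 3) :=
  Matrix.fromBlocks !![2, 1; 0, 2] !![0, 2; 0, 1] !![1, 2; 0, 0] !![2, 1; 2, 2]

theorem exists_q_sp : ∃ q : (Matrix.symplecticGroup (Fin 2) (ZMod 3) ⧸
      Subgroup.center (Matrix.symplecticGroup (Fin 2) (ZMod 3))),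
    q ≠ 1 ∧ q ^ 5 = 1 := by
  refine exists_q_quot 5 ⟨spA, ?_⟩ (SymplecticGroup.symJ (Fin 2) (ZMod 3)) ?_ ?_
  · rw [SymplecticGroup.mem_iff]; decide
  · apply Subtype.ext
    change spA ^ 5 = 1
    decide
  · intro h
    have := congrArg Subtype.val h
    change Matrix.J (Fin 2) (ZMod 3) * spA = spA * Matrix.J (Fin 2) (ZMod 3) at this
    exact absurd this (by decide)

theorem exists_q_all (G : Type) [Group G] (hlist : CentralQuotientInList G) :
    ∃ p : ℕ, p.Prime ∧ 5 ≤ p ∧ ∃ q : G ⧸ Subgroup.center G, q ≠ 1 ∧ q ^ p = 1 := by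
  have key : ∀ {H : Type} [Group H] (p : ℕ), (∃ q : H, q ≠ 1 ∧ q ^ p = 1) →
      (G ⧸ Subgroup.center G ≃* H) → ∃ q : G ⧸ Subgroup.center G, q ≠ 1 ∧ q ^ p = 1 := by
    rintro H _ p ⟨q, h1, h2⟩ e
    exact ⟨e.symm q, by simpa using h1, by rw [← map_pow, h2, map_one]⟩
  rcases hlist with ⟨⟨e⟩⟩ | ⟨⟨e⟩⟩ | ⟨⟨e⟩⟩ | ⟨⟨e⟩⟩ | ⟨⟨e⟩⟩
  · exact ⟨5, by norm_num, by norm_num, key 5 (exists_q_alt 6 (by simp)) e⟩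
  · exact ⟨5, by norm_num, by norm_num, key 5 (exists_q_alt 7 (by simp)) e⟩
  · exact ⟨7, by norm_num, by norm_num, key 7 exists_q_seven e⟩
  · exact ⟨11, by norm_num, by norm_num, key 11 exists_q_eleven e⟩
  · exact ⟨5, by norm_num, by norm_num, key 5 exists_q_sp e⟩

/-- A finite quasi-simple group `G` with nontrivial center whose central quotient is one of
`A₆`, `A₇`, `PSL₂(F₇)`, `PSL₂(F₁₁)`, `PSp₄(F₃)` (equivalently, `G` is one of `SL₂(F₇)`,
`SL₂(F₁₁)`, `Sp₄(F₃)`, `n.A₆` or `n.A₇` with `n ∈ {2,3,6}`) admits no nontrivial homomorphism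
to `GL₃(ℚ)`; in particular every rational representation of `G` of dimension at most `3` is
trivial. -/
theorem quasisimple_no_rational_rep_dim_le_three (G : Type) [Group G] [Finite G]
    (hqs : IsQuasiSimple G) (hz : Nontrivial (Subgroup.center G))
    (hlist : CentralQuotientInList G) :
    (∀ f : G →* GL (Fin 3) ℚ, ∀ g : G, f g = 1) ∧
    (∀ (V : Type) (_ : AddCommGroup V) (_ : Module ℚ V) (_ : FiniteDimensional ℚ V),
      Module.finrank ℚ V ≤ 3 →
      ∀ ρ : Representation ℚ G V, ∀ g : G, ρ g = LinearMap.id) := by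
  obtain ⟨p, hp, h5, q, hq, hqp⟩ := exists_q_all G hlist
  refine ⟨?_, ?_⟩
  · intro f g
    have h := rep_trivial_aux G hqs hp h5 q hq hqp (V := Fin 3 → ℚ) (by simp)
      (((Matrix.toLinAlgEquiv' : Matrix (Fin 3) (Fin 3) ℚ ≃ₐ[ℚ] _).toRingEquiv.toMulEquiv.toMonoidHom.comp
        (Units.coeHom _)).comp f) g
    apply Units.ext
    apply (Matrix.toLinAlgEquiv' : Matrix (Fin 3) (Fin 3) ℚ ≃ₐ[ℚ] _).injective
    rw [Units.val_one, map_one]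
    exact h
  · intro V _ _ _ hV ρ g
    exact rep_trivial_aux G hqs hp h5 q hq hqp hV ρ g
end

section
/- Let V be an irreducible five-dimensional complex representation of the simple group PSL2(F11). Then the exterior square ∧²V is an irreducible ten-dimensional representation of PSL2(F11). -/
open scoped TensorProduct

/-- The simple group `PSL₂(F₁₁)`. -/
abbrev PSL2F11 : Type := Matrix.ProjectiveSpecialLinearGroup (Fin 2) (ZMod 11)

/-- The exterior square `∧²V`, realised (in characteristic zero) as the subspace of
antisymmetric tensors of `V ⊗ V`, i.e. the span of the elements `v ⊗ w - w ⊗ v`. -/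
noncomputable def altSquare (V : Type*) [AddCommGroup V] [Module ℂ V] :
    Submodule ℂ (V ⊗[ℂ] V) :=
  Submodule.span ℂ {x | ∃ v w : V, x = v ⊗ₜ[ℂ] w - w ⊗ₜ[ℂ] v}

namespace PSLaux

abbrev SL := Matrix.SpecialLinearGroup (Fin 2) (ZMod 11)

instance : Fact (Nat.Prime 11) := ⟨by norm_num⟩

def gu (x : ZMod 11) : SL := ⟨!![1, x; 0, 1], by simp⟩
def gl (x : ZMod 11) : SL := ⟨!![1, 0; x, 1], by simp⟩
@[simp] lemma gu_coe (x : ZMod 11) : (gu x : Matrix (Fin 2) (Fin 2) (ZMod 11)) = !![1, x; 0, 1] := rfl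
@[simp] lemma gl_coe (x : ZMod 11) : (gl x : Matrix (Fin 2) (Fin 2) (ZMod 11)) = !![1, 0; x, 1] := rfl
def gs : SL := ⟨!![0, -1; 1, 0], by simp⟩
@[simp] lemma gs_coe : (gs : Matrix (Fin 2) (Fin 2) (ZMod 11)) = !![0, -1; 1, 0] := rfl
def gr : SL := ⟨!![1, 3; 3, 10], by decide⟩
def gx : SL := ⟨!![2, 2; 0, 6], by decide⟩
def gy : SL := ⟨!![1, 3; 6, 8], by decide⟩
def gt : SL := ⟨!![9, 0; 0, 5], by decide⟩

lemma gu_pow (n : ℕ) : gu 1 ^ n = gu n := by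
  induction n with
  | zero => ext i j; fin_cases i <;> fin_cases j <;> simp
  | succ n ih =>
    rw [pow_succ, ih]; ext i j
    fin_cases i <;> fin_cases j <;> simp [Matrix.mul_apply, Fin.sum_univ_two, add_comm]

lemma gu_eq (x : ZMod 11) : gu x = gu 1 ^ x.val := by
  rw [gu_pow]; simp

lemma gl_eq (x : ZMod 11) : gs * gu (-x) = gl x * gs := by
  ext i j
  fin_cases i <;> fin_cases j <;> simp [Matrix.mul_apply, Fin.sum_univ_two]

lemma decomp (g : SL) (h : g 1 0 ≠ 0) :
    g = gu ((g 0 0 - 1) / g 1 0) * gl (g 1 0) * gu ((g 1 1 - 1) / g 1 0) := by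
  have hd := g.det_coe
  rw [Matrix.det_fin_two] at hd
  have hb : g 0 1 = (g 0 0 * g 1 1 - 1) / g 1 0 := by
    field_simp; linear_combination -hd
  ext i j
  fin_cases i <;> fin_cases j <;>
    simp [Matrix.mul_apply, Fin.sum_univ_two, hb] <;> field_simp <;> ring

variable {H : Type*} [Monoid H]

lemma triv_of_u (R : SL →* H) (h : R (gu 1) = 1) (g : SL) : R g = 1 := by
  have hu : ∀ x, R (gu x) = 1 := fun x => by rw [gu_eq, map_pow, h, one_pow]
  have hl : ∀ x, R (gl x) = 1 := fun x => by
    have : gl x = gs * gu (-x) * gs⁻¹ := by rw [gl_eq]; group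
    rw [this, map_mul, map_mul, hu, mul_one, ← map_mul, mul_inv_cancel, map_one]
  have key : ∀ g : SL, g 1 0 ≠ 0 → R g = 1 := fun g hg => by
    rw [decomp g hg]; simp [hu, hl]
  by_cases hc : g 1 0 = 0
  · have hd := g.det_coe
    rw [Matrix.det_fin_two] at hd
    have h1 : (gl 1 * g : SL) 1 0 ≠ 0 := by
      have : (gl 1 * g : SL) 1 0 = g 0 0 := by
        simp [Matrix.mul_apply, Fin.sum_univ_two, hc]
      rw [this]; intro h0; simp [h0, hc] at hd
    have := key _ h1
    rwa [map_mul, hl, one_mul] at this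
  · exact key g hc

lemma gt_conj : gu 1 * gt = gt * gu 1 ^ 3 := by rw [gu_pow]; decide
lemma gt_five : gt ^ 5 = 1 := by decide
lemma gu_eleven : gu 1 ^ 11 = 1 := by rw [gu_pow]; decide
lemma gs_gt : gs = gt * gs * gt := by decide
lemma gs_sq : gs * gs = -1 := by decide
lemma gr_sq : gr * gr = -1 := by decide
lemma gs_gr : gs * gr = - 1 * (gr * gs) := by decide
lemma gx_conj : gx * gs = gr * gx := by decide
lemma gy_conj : gy * gs = gs * gr * gy := by decide

lemma triv_of_s (R : SL →* H) (h : R gs = 1) (g : SL) : R g = 1 := by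
  apply triv_of_u
  have h5 : R gt ^ 5 = 1 := by rw [← map_pow, gt_five, map_one]
  have h2 : R gt ^ 2 = 1 := by
    have := congrArg R gs_gt
    rw [map_mul, map_mul, h, mul_one] at this
    rw [pow_two, ← this]
  have ht : R gt = 1 := by
    calc R gt = (R gt ^ 2) ^ 3 * 1 := by
            rw [← pow_mul]; rw [show 2 * 3 = 5 + 1 from rfl, pow_succ, h5]; simp
      _ = 1 := by rw [h2]; simp
  have h11 : R (gu 1) ^ 11 = 1 := by rw [← map_pow, gu_eleven, map_one]
  have h3 : R (gu 1) = R (gu 1) ^ 3 := by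
    have := congrArg R gt_conj
    simpa [ht] using this
  have h2' : R (gu 1) ^ 2 = 1 := by
    have : R (gu 1) ^ 11 * R (gu 1) ^ 2 = R (gu 1) ^ 10 * R (gu 1) ^ 3 := by
      rw [← pow_add, ← pow_add]
    rw [← h3, ← pow_succ, h11, one_mul] at this
    exact this
  calc R (gu 1) = R (gu 1) ^ 3 := h3
    _ = R (gu 1) * 1 := by rw [← h2', ← pow_succ']
    _ = R (gu 1) ^ 11 := by
      have : R (gu 1) ^ (1 + 2 * 5) = R (gu 1) * 1 := by rw [pow_add, pow_mul, h2']; simp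
      exact this.symm
    _ = 1 := h11

set_option linter.unusedSectionVars false
section rank
variable {M : Type*} [AddCommGroup M] [Module ℂ M] [FiniteDimensional ℂ M]

lemma idem_trace (e : Module.End ℂ M) (h : IsIdempotentElem e) :
    LinearMap.trace ℂ M e = (Module.finrank ℂ (LinearMap.range e) : ℂ) :=
  (LinearMap.IsIdempotentElem.isProj_range _ h).trace

noncomputable def QQ (R : SL →* Module.End ℂ M) : Module.End ℂ M :=
  (1/4 : ℂ) • (1 + R gs + R gr + R gs * R gr)

lemma Rs_sq (R : SL →* Module.End ℂ M) (hn : R (-1) = 1) : R gs * R gs = 1 := by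
  rw [← map_mul, gs_sq, hn]
lemma Rr_sq (R : SL →* Module.End ℂ M) (hn : R (-1) = 1) : R gr * R gr = 1 := by
  rw [← map_mul, gr_sq, hn]
lemma Rrs (R : SL →* Module.End ℂ M) (hn : R (-1) = 1) : R gr * R gs = R gs * R gr := by
  rw [← map_mul, ← map_mul, gs_gr, map_mul R (-1), hn, one_mul]
lemma Rsr_sq (R : SL →* Module.End ℂ M) (hn : R (-1) = 1) :
    (R gs * R gr) * (R gs * R gr) = 1 := by
  rw [mul_assoc, ← mul_assoc (R gr), Rrs R hn, mul_assoc, Rr_sq R hn, mul_one, Rs_sq R hn]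
lemma tr_conj (R : SL →* Module.End ℂ M) (x a b : SL) (h : x * a = b * x) :
    LinearMap.trace ℂ M (R b) = LinearMap.trace ℂ M (R a) := by
  have hb : b = x * (a * x⁻¹) := by rw [← mul_assoc, h]; group
  rw [hb, map_mul, LinearMap.trace_mul_comm, ← map_mul]; congr 2; group
lemma tr_r (R : SL →* Module.End ℂ M) :
    LinearMap.trace ℂ M (R gr) = LinearMap.trace ℂ M (R gs) := tr_conj R gx _ _ gx_conj
lemma tr_sr (R : SL →* Module.End ℂ M) :
    LinearMap.trace ℂ M (R gs * R gr) = LinearMap.trace ℂ M (R gs) := by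
  rw [← map_mul]; exact tr_conj R gy _ _ gy_conj

lemma QQ_idem (R : SL →* Module.End ℂ M) (hn : R (-1) = 1) : IsIdempotentElem (QQ R) := by
  have h1 := Rs_sq R hn
  have h2 := Rr_sq R hn
  have h3 := Rrs R hn
  have h4 := Rsr_sq R hn
  have h5 : R gs * (R gs * R gr) = R gr := by rw [← mul_assoc, h1, one_mul]
  have h6 : R gr * (R gs * R gr) = R gs := by rw [← mul_assoc, h3, mul_assoc, h2, mul_one]
  have h7 : (R gs * R gr) * R gs = R gr := by rw [mul_assoc, h3, ← mul_assoc, h1, one_mul]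
  have h8 : (R gs * R gr) * R gr = R gs := by rw [mul_assoc, h2, mul_one]
  unfold IsIdempotentElem QQ
  rw [smul_mul_smul_comm]
  simp only [mul_add, add_mul, mul_one, one_mul, h1, h2, h3, h4, h5, h6, h7, h8]
  module

lemma QQ_trace (R : SL →* Module.End ℂ M) : LinearMap.trace ℂ M (QQ R)
    = (1/4) * (Module.finrank ℂ M + 3 * LinearMap.trace ℂ M (R gs)) := by
  simp only [QQ, map_smul, map_add, tr_r, tr_sr, LinearMap.trace_one, smul_eq_mul]
  ring

lemma five (R : SL →* Module.End ℂ M) (hn : R (-1) = 1) (h5 : Module.finrank ℂ M = 5) :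
    (LinearMap.trace ℂ M (R gs) = 1 ∨ R gs = 1) ∧
      2 ≤ Module.finrank ℂ (LinearMap.range (QQ R)) := by
  have hQ := idem_trace _ (QQ_idem R hn)
  rw [QQ_trace, h5] at hQ
  have hp : ∀ ε : ℂ, ε * ε = 1 → IsIdempotentElem ((1/2 : ℂ) • (1 + ε • R gs)) := by
    intro ε he
    unfold IsIdempotentElem
    rw [smul_mul_smul_comm]
    simp only [mul_add, add_mul, mul_one, one_mul, smul_mul_smul_comm, Rs_sq R hn, he]
    module
  have hP := idem_trace _ (hp 1 (by norm_num))
  have hN := idem_trace _ (hp (-1) (by norm_num))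
  simp only [map_smul, map_add, LinearMap.trace_one, smul_eq_mul, h5] at hP hN
  generalize hm : Module.finrank ℂ (LinearMap.range ((1/2 : ℂ) • (1 + (1:ℂ) • R gs))) = m at hP
  generalize hk : Module.finrank ℂ (LinearMap.range ((1/2 : ℂ) • (1 + (-1:ℂ) • R gs))) = k at hN
  generalize Module.finrank ℂ (LinearMap.range (QQ R)) = n at *
  have e1 : (m + k : ℂ) = 5 := by rw [← hP, ← hN]; push_cast; ring
  have e2 : (2 * n + 5 : ℂ) = 3 * m := by rw [← hP, ← hQ]; push_cast; ring
  norm_cast at e1 e2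
  refine ⟨?_, by omega⟩
  have : m = 3 ∨ k = 0 := by omega
  rcases this with h | h
  · left
    rw [h] at hP
    push_cast at hP
    linear_combination 2 * hP
  · right
    rw [h] at hk
    have := Submodule.finrank_eq_zero.1 hk
    rw [LinearMap.range_eq_bot] at this
    have h2 : (1 : Module.End ℂ M) - R gs = 0 := by
      have := congrArg (fun x => (2:ℂ) • x) this
      simp only [smul_zero] at this
      rw [← this]; module
    exact (sub_eq_zero.1 h2).symm
end rank

section tens
variable {V : Type} [AddCommGroup V] [Module ℂ V] [FiniteDimensional ℂ V]

noncomputable def sw : Module.End ℂ (V ⊗[ℂ] V) := (TensorProduct.comm ℂ V V).toLinearMap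

@[simp] lemma sw_tmul (x y : V) : sw (x ⊗ₜ[ℂ] y) = y ⊗ₜ[ℂ] x := rfl

lemma tr_sw (f : Module.End ℂ V) :
    LinearMap.trace ℂ (V ⊗[ℂ] V) (sw * TensorProduct.map f f) = LinearMap.trace ℂ V (f * f) := by
  let b := Module.finBasis ℂ V
  rw [LinearMap.trace_eq_matrix_trace ℂ (b.tensorProduct b),
    LinearMap.trace_eq_matrix_trace ℂ b, LinearMap.toMatrix_mul b f f]
  simp only [Matrix.trace, Matrix.diag, Fintype.sum_prod_type, Matrix.mul_apply]
  refine Finset.sum_congr rfl fun i _ => Finset.sum_congr rfl fun j _ => ?_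
  simp [LinearMap.toMatrix_apply, mul_comm]

lemma sw_sq : (sw : Module.End ℂ (V ⊗[ℂ] V)) * sw = 1 := by
  ext x y; simp

noncomputable def R2 (R : SL →* Module.End ℂ V) : SL →* Module.End ℂ (V ⊗[ℂ] V) :=
  Representation.tprod (k := ℂ) (G := SL) R R

lemma R2_apply (R : SL →* Module.End ℂ V) (g : SL) : R2 R g = TensorProduct.map (R g) (R g) := rfl

lemma sw_comm (R : SL →* Module.End ℂ V) (g : SL) : R2 R g * sw = sw * R2 R g := by
  ext x y; simp [R2_apply]

lemma sw_alt (x : V ⊗[ℂ] V) (hx : x ∈ altSquare V) : sw x = -x := by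
  unfold altSquare at hx
  induction hx using Submodule.span_induction with
  | mem x h => obtain ⟨v, w, rfl⟩ := h; simp
  | zero => simp
  | add x y _ _ hx hy => rw [map_add, hx, hy]; abel
  | smul a x _ hx => rw [map_smul, hx]; simp

noncomputable def EE : Module.End ℂ (V ⊗[ℂ] V) := (1/2 : ℂ) • (1 - sw)

lemma EE_idem : IsIdempotentElem (EE : Module.End ℂ (V ⊗[ℂ] V)) := by
  unfold IsIdempotentElem EE
  rw [smul_mul_smul_comm]
  simp only [mul_sub, sub_mul, mul_one, one_mul, sw_sq]
  module

lemma EE_comm (R : SL →* Module.End ℂ V) : QQ (R2 R) * EE = EE * QQ (R2 R) := by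
  unfold QQ EE
  simp only [smul_mul_smul_comm, mul_sub, sub_mul, mul_add, add_mul, one_mul, mul_one, ← map_mul,
    sw_comm]
  module

lemma R2_neg (R : SL →* Module.End ℂ V) (hn : R (-1) = 1) : R2 R (-1) = 1 := by
  rw [R2_apply, hn]; exact TensorProduct.map_one

lemma PP_idem (R : SL →* Module.End ℂ V) (hn : R (-1) = 1) :
    IsIdempotentElem (EE * QQ (R2 R)) := by
  unfold IsIdempotentElem
  rw [mul_assoc, ← mul_assoc (QQ _), EE_comm, mul_assoc, QQ_idem (R2 R) (R2_neg R hn), ← mul_assoc,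
    EE_idem]

lemma PP_trace (R : SL →* Module.End ℂ V) (hn : R (-1) = 1) (h5 : Module.finrank ℂ V = 5)
    (h1 : LinearMap.trace ℂ V (R gs) = 1) :
    LinearMap.trace ℂ _ (EE * QQ (R2 R)) = 1 := by
  have a0 : LinearMap.trace ℂ (V ⊗[ℂ] V) sw = 5 := by
    have := tr_sw (1 : Module.End ℂ V)
    rw [TensorProduct.map_one, mul_one, mul_one, LinearMap.trace_one, h5] at this
    exact_mod_cast this
  have a1 : ∀ g, R g * R g = 1 → LinearMap.trace ℂ _ (sw * R2 R g) = 5 := fun g hg => by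
    rw [R2_apply, tr_sw, hg, LinearMap.trace_one, h5]; norm_num
  have a2 : ∀ g, LinearMap.trace ℂ V (R g) = 1 → LinearMap.trace ℂ _ (R2 R g) = 1 := fun g hg => by
    rw [R2_apply, LinearMap.trace_tensorProduct', hg]; norm_num
  have b1 := a1 _ (Rs_sq R hn)
  have b2 := a1 _ (Rr_sq R hn)
  have b3 := a1 (gs * gr) (by rw [map_mul]; exact Rsr_sq R hn)
  have c1 := a2 _ h1
  have c2 := a2 _ ((tr_r R).trans h1)
  have c3 := a2 (gs * gr) (by rw [map_mul]; exact (tr_sr R).trans h1)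
  simp only [QQ, EE, smul_mul_smul_comm, sub_mul, mul_add, one_mul, mul_one, ← map_mul (R2 R),
    map_smul, map_add, map_sub, a0, b1, b2, b3, c1, c2, c3, LinearMap.trace_one,
    Module.finrank_tensorProduct, h5]
  norm_num

lemma no_five (R : SL →* Module.End ℂ V) (hn : R (-1) = 1) (h5 : Module.finrank ℂ V = 5)
    (h1 : LinearMap.trace ℂ V (R gs) = 1) (W : Submodule ℂ (V ⊗[ℂ] V)) (hW : W ≤ altSquare V)
    (hinv : ∀ g, ∀ x ∈ W, R2 R g x ∈ W) : Module.finrank ℂ W ≠ 5 := by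
  intro hW5
  let RW : SL →* Module.End ℂ W :=
    Representation.subrepresentation (k := ℂ) (G := SL) (R2 R) W (fun g x hx => hinv g x hx)
  have hRW : ∀ g (x : W), (RW g x : V ⊗[ℂ] V) = R2 R g x := fun g x => rfl
  have hnW : RW (-1) = 1 := by
    ext x; rw [hRW, R2_neg R hn]; rfl
  have h2 := (five RW hnW hW5).2
  have hP := idem_trace _ (PP_idem R hn)
  rw [PP_trace R hn h5 h1] at hP
  have hQ : ∀ x : W, (QQ RW x : V ⊗[ℂ] V) = QQ (R2 R) x := fun x => by
    simp [QQ, hRW]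
  have hle : (LinearMap.range (QQ RW)).map W.subtype ≤ LinearMap.range (EE * QQ (R2 R)) := by
    rintro _ ⟨_, ⟨x, rfl⟩, rfl⟩
    refine ⟨x, ?_⟩
    rw [Submodule.subtype_apply, Module.End.mul_apply, ← hQ]
    have := sw_alt _ (hW (QQ RW x).2)
    simp only [EE, LinearMap.smul_apply, LinearMap.sub_apply, this, Module.End.one_apply]
    module
  have := Submodule.finrank_mono hle
  rw [Submodule.finrank_map_subtype_eq] at this
  have hP' : Module.finrank ℂ (LinearMap.range (EE * QQ (R2 R))) = 1 := by exact_mod_cast hP.symm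
  omega
end tens

section eig
variable {V : Type} [AddCommGroup V] [Module ℂ V] [FiniteDimensional ℂ V]

lemma exists_eig (u : Module.End ℂ V) (h1 : u ≠ 1) (h11 : u ^ 11 = 1) :
    ∃ (v : V) (μ : ℂ), v ≠ 0 ∧ u v = μ • v ∧ orderOf μ = 11 := by
  let K := LinearMap.range (u - 1)
  have hK : ∀ x ∈ K, u x ∈ K := by
    rintro _ ⟨w, rfl⟩
    exact ⟨u w, by simp⟩
  have : Nontrivial K := by
    rw [Submodule.nontrivial_iff_ne_bot]
    intro h
    exact h1 (sub_eq_zero.1 (LinearMap.range_eq_bot.1 h))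
  obtain ⟨μ, hμ⟩ := Module.End.exists_eigenvalue (u.restrict hK)
  obtain ⟨x, hx⟩ := hμ.exists_hasEigenvector
  have hxu : u x = μ • (x : V) := by
    have := hx.apply_eq_smul
    exact congrArg Subtype.val this
  have hx0 : (x : V) ≠ 0 := by
    intro h; exact hx.2 (Subtype.ext h)
  have hpow : ∀ n : ℕ, (u ^ n) (x : V) = μ ^ n • (x : V) := by
    intro n
    induction n with
    | zero => simp
    | succ n ih => rw [pow_succ', Module.End.mul_apply, ih, map_smul, hxu, smul_smul, pow_succ]
  refine ⟨x, μ, hx0, hxu, ?_⟩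
  have hm : μ ^ 11 = 1 := by
    have := hpow 11
    rw [h11, Module.End.one_apply] at this
    have h2 : (μ ^ 11 - 1) • (x : V) = 0 := by rw [sub_smul, ← this]; simp
    rcases smul_eq_zero.1 h2 with h | h
    · exact sub_eq_zero.1 h
    · exact absurd h hx0
  refine orderOf_eq_prime hm ?_
  rintro rfl
  obtain ⟨w, hw⟩ := x.2
  rw [one_smul] at hxu
  have huw : u w = w + x := by rw [← hw]; simp
  have : ∀ n : ℕ, (u ^ n) w = w + (n : ℂ) • (x : V) := by
    intro n
    induction n with
    | zero => simp
    | succ n ih =>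
      rw [pow_succ', Module.End.mul_apply, ih, map_add, map_smul, hxu, huw]
      push_cast
      module
  have h := this 11
  rw [h11, Module.End.one_apply] at h
  have h3 : ((11 : ℕ) : ℂ) • (x : V) = 0 := by simpa using h
  rcases smul_eq_zero.1 h3 with h | h
  · norm_num at h
  · exact hx0 h

lemma comp_mem {ι M : Type*} [AddCommGroup M] [Module ℂ M] (U : Module.End ℂ M) (f : ι → M)
    (μ : ι → ℂ) (hμ : Function.Injective μ) (hf : ∀ i, U (f i) = μ i • f i) (W : Submodule ℂ M)
    (hW : ∀ x ∈ W, U x ∈ W) (s : Finset ι) :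
    ∀ c : ι → ℂ, ∑ p ∈ s, c p • f p ∈ W → ∀ p ∈ s, c p • f p ∈ W := by
  classical
  induction s using Finset.induction_on with
  | empty => simp
  | insert q s hq ih =>
    intro c hc
    rw [Finset.sum_insert hq] at hc
    have h1 : ∑ p ∈ s, (c p * (μ p - μ q)) • f p ∈ W := by
      have h := W.sub_mem (hW _ hc) (W.smul_mem (μ q) hc)
      convert h using 1
      simp only [map_add, map_smul, map_sum, hf, smul_add, Finset.smul_sum]
      have : ∀ a b c d : M, a = c → (a + b) - (c + d) = b - d := by
        rintro a b c d rfl; abel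
      rw [this _ _ _ _ (by module), ← Finset.sum_sub_distrib]
      exact Finset.sum_congr rfl fun p _ => by module
    have h2 : ∀ p ∈ s, c p • f p ∈ W := by
      intro p hp
      have := ih _ h1 p hp
      have hne : μ p - μ q ≠ 0 := by
        rw [sub_ne_zero]; intro h; exact hq (hμ h ▸ hp)
      have h3 := W.smul_mem (μ p - μ q)⁻¹ this
      rw [smul_smul] at h3
      convert h3 using 2
      field_simp
    have h3 : c q • f q ∈ W := by
      have := W.sub_mem hc (W.sum_mem h2)
      simpa using this
    intro p hp
    rcases Finset.mem_insert.1 hp with rfl | hp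
    · exact h3
    · exact h2 p hp

def sh (d : Fin 2) : Fin 5 := if d = 0 then 1 else 2
def wt (p : Fin 2 × Fin 5) : ℕ := 3 ^ p.2.val + 3 ^ (p.2 + sh p.1).val

lemma wt_inj : ∀ p q, wt p % 11 = wt q % 11 → p = q := by decide
lemma wt1_inj : ∀ p q : Fin 5, 3 ^ p.val % 11 = 3 ^ q.val % 11 → p = q := by decide
lemma sh_ne : ∀ (d : Fin 2) (i : Fin 5), i ≠ i + sh d := by decide
lemma pairs : ∀ i j : Fin 5, i = j ∨ ∃ d, j = i + sh d ∨ i = j + sh d := by decide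

lemma reach : ∀ i j : Fin 5, ∃ n : Fin 5, (fun k : Fin 5 => k + 1)^[n.val] i = j := by decide

lemma main (R : SL →* Module.End ℂ V) (hn : R (-1) = 1) (h5 : Module.finrank ℂ V = 5)
    (hnt : R gs ≠ 1) :
    Module.finrank ℂ (altSquare V) = 10 ∧
    (∀ W : Submodule ℂ (V ⊗[ℂ] V), W ≤ altSquare V →
      (∀ g, ∀ x ∈ W, R2 R g x ∈ W) → W = ⊥ ∨ W = altSquare V) := by
  have h1 : LinearMap.trace ℂ V (R gs) = 1 := by
    rcases (five R hn h5).1 with h | h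
    · exact h
    · exact absurd h hnt
  have hu : R (gu 1) ≠ 1 := fun h => hnt (triv_of_u R h _)
  obtain ⟨v, μ, hv, huv, hord⟩ := exists_eig (R (gu 1)) hu
    (by rw [← map_pow, gu_eleven, map_one])
  have hpm : ∀ a b : ℕ, μ ^ a = μ ^ b → a % 11 = b % 11 := by
    intro a b h
    rw [← pow_mod_orderOf, ← pow_mod_orderOf μ b, hord] at h
    refine pow_injOn_Iio_orderOf (x := μ) ?_ ?_ h
    · rw [hord]; exact Nat.mod_lt _ (by norm_num)
    · rw [hord]; exact Nat.mod_lt _ (by norm_num)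
  have ht5 : R gt ^ 5 = 1 := by rw [← map_pow, gt_five, map_one]
  have hstep : ∀ (x : V) (c : ℂ), R (gu 1) x = c • x → R (gu 1) (R gt x) = c ^ 3 • R gt x := by
    intro x c hx
    rw [← Module.End.mul_apply, ← map_mul, gt_conj, map_mul, map_pow, Module.End.mul_apply]
    simp only [pow_succ, pow_zero, one_mul, Module.End.mul_apply, hx, map_smul, smul_smul, mul_assoc]
  have hE : ∀ n : ℕ, R (gu 1) ((R gt ^ n) v) = μ ^ (3 ^ n) • (R gt ^ n) v := by
    intro n
    induction n with
    | zero => simpa using huv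
    | succ n ih =>
      rw [pow_succ', Module.End.mul_apply, hstep _ _ ih, ← pow_mul, ← pow_succ]
  let e : Fin 5 → V := fun i => (R gt ^ i.val) v
  have he : ∀ i, R (gu 1) (e i) = μ ^ (3 ^ i.val) • e i := fun i => hE _
  have het : ∀ i, R gt (e i) = e (i + 1) := by
    intro i
    have h : R gt (e i) = (R gt ^ (i.val + 1)) v := by rw [pow_succ']; rfl
    rw [h]
    fin_cases i <;> simp [e]
    rw [ht5]; rfl
  have he0 : ∀ i, e i ≠ 0 := by
    intro i h
    apply hv
    have h2 : (R gt ^ (5 - i.val)) (e i) = v := by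
      show (R gt ^ (5 - i.val)) ((R gt ^ i.val) v) = v
      rw [← Module.End.mul_apply, ← pow_add, Nat.sub_add_cancel i.2.le, ht5]; rfl
    rw [← h2, h, map_zero]
  have heLI : LinearIndependent ℂ e :=
    Module.End.eigenvectors_linearIndependent' (R (gu 1)) (fun i : Fin 5 => μ ^ (3 ^ i.val))
      (fun i j h => wt1_inj i j (by
        have := hpm _ _ h
        exact this)) e
      (fun i => ⟨Module.End.mem_eigenspace_iff.2 (he i), he0 i⟩)
  let b : Module.Basis (Fin 5) ℂ V := basisOfLinearIndependentOfCardEqFinrank heLI (by simp [h5])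
  have hb : ∀ i, b i = e i := fun i => by simp [b]
  let f : Fin 2 × Fin 5 → V ⊗[ℂ] V := fun p =>
    e p.2 ⊗ₜ[ℂ] e (p.2 + sh p.1) - e (p.2 + sh p.1) ⊗ₜ[ℂ] e p.2
  have hf : ∀ p, R2 R (gu 1) (f p) = μ ^ (wt p) • f p := by
    intro p
    simp only [f, R2_apply, map_sub, TensorProduct.map_tmul, he, wt, pow_add, TensorProduct.smul_tmul_smul]
    module
  have hft : ∀ d i, R2 R gt (f (d, i)) = f (d, i + 1) := by
    intro d i
    simp only [f, R2_apply, map_sub, TensorProduct.map_tmul, het]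
    rw [add_right_comm]
  have hf0 : ∀ p, f p ≠ 0 := by
    intro p h
    have h2 := sub_eq_zero.1 h
    simp only [← hb, ← Module.Basis.tensorProduct_apply] at h2
    have := (b.tensorProduct b).injective h2
    exact sh_ne _ _ (Prod.ext_iff.1 this).1
  have hinj : Function.Injective (fun p => μ ^ wt p) := fun p q h => wt_inj p q (by
        have := hpm _ _ h
        exact this)
  have hfLI : LinearIndependent ℂ f :=
    Module.End.eigenvectors_linearIndependent' (R2 R (gu 1)) (fun p => μ ^ wt p) hinj f
      (fun i => ⟨Module.End.mem_eigenspace_iff.2 (hf i), hf0 i⟩)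
  have hij : ∀ i j, e i ⊗ₜ[ℂ] e j - e j ⊗ₜ[ℂ] e i ∈ Submodule.span ℂ (Set.range f) := by
    intro i j
    rcases pairs i j with rfl | ⟨d, rfl | rfl⟩
    · simp
    · exact Submodule.subset_span ⟨(d, i), rfl⟩
    · rw [← neg_sub]
      exact Submodule.neg_mem _ (Submodule.subset_span ⟨(d, j), rfl⟩)
  have hspan : Submodule.span ℂ (Set.range f) = altSquare V := by
    apply le_antisymm
    · rw [Submodule.span_le]
      rintro _ ⟨p, rfl⟩
      exact Submodule.subset_span ⟨_, _, rfl⟩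
    · unfold altSquare
      rw [Submodule.span_le]
      rintro _ ⟨x, y, rfl⟩
      rw [SetLike.mem_coe, ← b.sum_repr x, ← b.sum_repr y]
      simp only [TensorProduct.sum_tmul, TensorProduct.tmul_sum, hb]
      rw [Finset.sum_comm (γ := Fin 5), ← Finset.sum_sub_distrib]
      refine Submodule.sum_mem _ fun i _ => ?_
      rw [← Finset.sum_sub_distrib]
      refine Submodule.sum_mem _ fun j _ => ?_
      simp only [TensorProduct.smul_tmul_smul]
      rw [mul_comm (b.repr y _), ← smul_sub]
      exact Submodule.smul_mem _ _ (hij _ _)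
  refine ⟨?_, ?_⟩
  · rw [← hspan, finrank_span_eq_card hfLI]; simp
  intro W hW hinv
  have hcomp : ∀ x ∈ W, ∃ c : Fin 2 × Fin 5 → ℂ, x = ∑ p, c p • f p ∧ ∀ p, f p ∉ W → c p = 0 := by
    intro x hx
    have hx' := hW hx
    rw [← hspan, Submodule.mem_span_range_iff_exists_fun] at hx'
    obtain ⟨c, hc⟩ := hx'
    refine ⟨c, hc.symm, fun p hp => ?_⟩
    by_contra h0
    have := comp_mem (R2 R (gu 1)) f _ hinj hf W (hinv _) Finset.univ c (by rw [hc]; exact hx) p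
      (Finset.mem_univ _)
    exact hp ((W.smul_mem_iff h0).1 this)
  have hshift : ∀ d i, f (d, i) ∈ W → ∀ j, f (d, j) ∈ W := by
    intro d i hi
    have h : ∀ n : ℕ, f (d, (fun k : Fin 5 => k + 1)^[n] i) ∈ W := by
      intro n
      induction n with
      | zero => simpa using hi
      | succ n ih =>
        have := hinv gt _ ih
        rw [hft] at this
        rwa [Function.iterate_succ_apply']
    intro j
    obtain ⟨n, hn⟩ := reach i j
    exact hn ▸ h n
  by_cases hall : ∀ p, f p ∈ W
  · right
    refine le_antisymm hW ?_
    rw [← hspan, Submodule.span_le]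
    rintro _ ⟨p, rfl⟩
    exact hall p
  by_cases hnone : ∀ p, f p ∉ W
  · left
    rw [eq_bot_iff]
    intro x hx
    obtain ⟨c, rfl, hc⟩ := hcomp x hx
    simp [hc _ (hnone _)]
  exfalso
  push Not at hall hnone
  obtain ⟨⟨d, i⟩, hd⟩ := hnone
  obtain ⟨⟨d', i'⟩, hd'⟩ := hall
  have hdd : d ≠ d' := by
    rintro rfl
    exact hd' (hshift _ _ hd _)
  have hd'' : ∀ k j, k ≠ d → f (k, j) ∉ W := by
    intro k j hk h
    have : k = d' := by omega
    subst this
    exact hd' (hshift _ _ h _)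
  have hWs : W = Submodule.span ℂ (Set.range fun j => f (d, j)) := by
    apply le_antisymm
    · intro x hx
      obtain ⟨c, rfl, hc⟩ := hcomp x hx
      refine Submodule.sum_mem _ ?_
      rintro ⟨k, j⟩ _
      by_cases hk : k = d
      · subst hk
        exact Submodule.smul_mem _ _ (Submodule.subset_span ⟨j, rfl⟩)
      · rw [hc _ (hd'' k j hk)]; simp
    · rw [Submodule.span_le]
      rintro _ ⟨j, rfl⟩
      exact hshift _ _ hd j
  refine no_five R hn h5 h1 W hW hinv ?_
  have := finrank_span_eq_card (hfLI.comp _ (Prod.mk_right_injective d))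
  rw [hWs]
  exact this
end eig

end PSLaux

/-- If `V` is an irreducible five-dimensional complex representation of the simple group
`PSL₂(F₁₁)`, then the exterior square `∧²V` (with the induced action `g ↦ (ρ g) ⊗ (ρ g)`) is an
irreducible ten-dimensional representation of `PSL₂(F₁₁)`. -/
theorem extSquare_of_five_dim_irreducible_PSL2F11
    (V : Type) [AddCommGroup V] [Module ℂ V] [FiniteDimensional ℂ V]
    (ρ : Representation ℂ PSL2F11 V)
    (hdim : Module.finrank ℂ V = 5)
    (hirr : ∀ W : Submodule ℂ V,
      (∀ g : PSL2F11, ∀ v ∈ W, ρ g v ∈ W) → W = ⊥ ∨ W = ⊤) :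
    Module.finrank ℂ (altSquare V) = 10 ∧
    (∀ g : PSL2F11,
      Submodule.map (TensorProduct.map (ρ g) (ρ g)) (altSquare V) ≤ altSquare V) ∧
    (∀ W : Submodule ℂ (V ⊗[ℂ] V), W ≤ altSquare V →
      (∀ g : PSL2F11, ∀ x ∈ W, TensorProduct.map (ρ g) (ρ g) x ∈ W) →
      W = ⊥ ∨ W = altSquare V) := by
  let R : PSLaux.SL →* Module.End ℂ V := ρ.comp (QuotientGroup.mk' _)
  have hR : ∀ g : PSLaux.SL, R g = ρ (QuotientGroup.mk g) := fun g => rfl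
  have hn : R (-1) = 1 := by
    have : (QuotientGroup.mk (-1 : PSLaux.SL) : PSL2F11) = 1 := by
      rw [QuotientGroup.eq_one_iff, Subgroup.mem_center_iff]
      intro g; simp
    rw [hR, this, map_one]
  have hnt : R PSLaux.gs ≠ 1 := by
    intro h
    have htriv := PSLaux.triv_of_s R h
    have hρ : ∀ g, ρ g = 1 := by
      intro g
      obtain ⟨g, rfl⟩ := QuotientGroup.mk_surjective g
      exact htriv g
    have : Nontrivial V := Module.nontrivial_of_finrank_pos (R := ℂ) (by omega)
    obtain ⟨v, hv⟩ := exists_ne (0 : V)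
    rcases hirr (Submodule.span ℂ {v}) (fun g x hx => by rw [hρ]; exact hx) with h | h
    · exact hv (Submodule.span_singleton_eq_bot.1 h)
    · have h1 := finrank_span_singleton (K := ℂ) hv
      rw [h, finrank_top] at h1
      omega
  obtain ⟨h10, hW⟩ := PSLaux.main R hn hdim hnt
  refine ⟨h10, ?_, fun W hle hinv => hW W hle fun g x hx => hinv (QuotientGroup.mk g) x hx⟩
  intro g
  unfold altSquare
  rw [Submodule.map_span, Submodule.span_le]
  rintro _ ⟨_, ⟨v, w, rfl⟩, rfl⟩
  exact Submodule.subset_span ⟨ρ g v, ρ g w, by simp⟩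
end
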